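/- arXiv:2003.10875 — 2 statements merged into one kernel-verified Lean document; each statement's English description precedes it below -/
import Mathlib

section
/- Let n ≥ 3, 0 ≤ l < k ≤ n with k ≥ 2, and let λ = (λ_1, …, λ_n) ∈ Γ_k satisfy λ_2 ≥ λ_3 ≥ ⋯ ≥ λ_n, λ_1 > 0, λ_n < 0, λ_1 ≥ δλ_2 and −λ_n ≥ ελ_1 for some constants δ, ε ∈ (0,1]. Set c_0 = min{ ε²δ²/(2(n−2)(n−1)), ε²δ/(4(n−1)) } and c_1 = (n/k)·((k−l)/(n−l))·c_0²/(n−k+1). Then σ_{k−1}(λ|1)σ_l(λ) − σ_k(λ)σ_{l−1}(λ|1) ≥ c_1 · Σ_{i=1}^n [σ_{k−1}(λ|i)σ_l(λ) − σ_k(λ)σ_{l−1}(λ|i)]; equivalently ∂[σ_k(λ)/σ_l(λ)]/∂λ_1 ≥ c_1 Σ_{i=1}^n ∂[σ_k(λ)/σ_l(λ)]/∂λ_i. (Lemma 2.7, inequality (2.15).) -/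
open Finset

noncomputable def esymm {n : ℕ} (lam : Fin n → ℝ) (m : ℤ) : ℝ :=
  if m < 0 then 0
  else ∑ s ∈ Finset.powersetCard m.toNat Finset.univ, ∏ i ∈ s, lam i

noncomputable def esymmDel {n : ℕ} (lam : Fin n → ℝ) (i : Fin n) (m : ℤ) : ℝ :=
  if m < 0 then 0
  else ∑ s ∈ Finset.powersetCard m.toNat (Finset.univ.erase i), ∏ j ∈ s, lam j

noncomputable def esymmDelSet {n : ℕ} (lam : Fin n → ℝ) (S : Finset (Fin n)) (m : ℤ) : ℝ :=
  if m < 0 then 0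
  else ∑ s ∈ Finset.powersetCard m.toNat (Finset.univ \ S), ∏ j ∈ s, lam j

def GardingCone (n k : ℕ) : Set (Fin n → ℝ) :=
  {lam | ∀ m : ℕ, 1 ≤ m → m ≤ k → 0 < esymm lam (m : ℤ)}

noncomputable def sigmaMat {n : ℕ} (A : Matrix (Fin n) (Fin n) ℝ) (m : ℤ) : ℝ :=
  if m < 0 then 0
  else ∑ s ∈ Finset.powersetCard m.toNat (Finset.univ : Finset (Fin n)),
    (A.submatrix (fun i : {x : Fin n // x ∈ s} => (i : Fin n))
                 (fun j : {x : Fin n // x ∈ s} => (j : Fin n))).det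


theorem natDegree_prod_X_add_C (s : Multiset ℝ) :
    (s.map fun r => Polynomial.X + Polynomial.C r).prod.natDegree = s.card := by
  rw [Polynomial.natDegree_multiset_prod_of_monic]
  · simp
  · simp [Polynomial.monic_X_add_C]

/-- Laguerre's inequality at the origin for a product of linear factors. -/
theorem laguerre_prod_X_add_C (s : Multiset ℝ) :
    2 * (s.card : ℝ) * ((s.map fun r => Polynomial.X + Polynomial.C r).prod.coeff 0 *
        (s.map fun r => Polynomial.X + Polynomial.C r).prod.coeff 2) ≤
      ((s.card : ℝ) - 1) * (s.map fun r => Polynomial.X + Polynomial.C r).prod.coeff 1 ^ 2 := by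
  induction s using Multiset.induction_on with
  | empty => simp [Polynomial.coeff_one]
  | cons r s ih =>
    rw [Multiset.map_cons, Multiset.prod_cons]
    rcases Multiset.empty_or_exists_mem s with rfl | ⟨x, hx⟩
    · simp [Polynomial.coeff_X, Polynomial.coeff_C]
    · have hN : 0 < (s.card : ℝ) := by exact_mod_cast Multiset.card_pos_iff_exists_mem.2 ⟨x, hx⟩
      generalize (s.map fun r => Polynomial.X + Polynomial.C r).prod = g at ih ⊢
      have h0 : ((Polynomial.X + Polynomial.C r) * g).coeff 0 = r * g.coeff 0 := by
        simp [add_mul]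
      have h1 : ((Polynomial.X + Polynomial.C r) * g).coeff 1 = g.coeff 0 + r * g.coeff 1 := by
        simp [add_mul, Polynomial.coeff_X_mul]
      have h2 : ((Polynomial.X + Polynomial.C r) * g).coeff 2 = g.coeff 1 + r * g.coeff 2 := by
        simp [add_mul, Polynomial.coeff_X_mul]
      rw [h0, h1, h2, Multiset.card_cons]
      push_cast
      generalize (s.card : ℝ) = N at *
      refine le_of_mul_le_mul_left ?_ hN
      nlinarith [sq_nonneg (N * g.coeff 0 - r * g.coeff 1),
        mul_le_mul_of_nonneg_left ih (mul_nonneg (add_pos hN one_pos).le (sq_nonneg r))]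

theorem Polynomial.Splits.laguerre {f : Polynomial ℝ} (hf : f.Splits) :
    2 * (f.natDegree : ℝ) * (f.coeff 0 * f.coeff 2) ≤
      ((f.natDegree : ℝ) - 1) * f.coeff 1 ^ 2 := by
  obtain ⟨s, hs⟩ := Polynomial.splits_iff_exists_multiset'.1 hf
  by_cases h0 : f = 0
  · simp [h0]
  have hd : f.natDegree = s.card := by
    rw [hs, Polynomial.natDegree_C_mul (Polynomial.leadingCoeff_ne_zero.2 h0),
      natDegree_prod_X_add_C]
  have key := mul_le_mul_of_nonneg_left (laguerre_prod_X_add_C s) (sq_nonneg f.leadingCoeff)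
  have hc (i : ℕ) : f.coeff i = f.leadingCoeff *
      (s.map fun r => Polynomial.X + Polynomial.C r).prod.coeff i := by
    rw [← Polynomial.coeff_C_mul, ← hs]
  rw [hd, hc 0, hc 1, hc 2]
  linarith

theorem Polynomial.Splits.derivative_real {f : Polynomial ℝ} (hf : f.Splits) :
    (Polynomial.derivative f).Splits := by
  rw [Polynomial.splits_iff_card_roots] at hf ⊢
  have h1 := Polynomial.card_roots_le_derivative f
  have h2 := Polynomial.card_roots' (Polynomial.derivative f)
  by_cases hd : f.natDegree = 0
  · rw [Polynomial.natDegree_eq_zero] at hd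
    obtain ⟨c, rfl⟩ := hd
    simp
  · have h3 := Polynomial.natDegree_derivative_le f
    omega

theorem Polynomial.Splits.iterate_derivative_real {f : Polynomial ℝ} (hf : f.Splits) (m : ℕ) :
    (Polynomial.derivative^[m] f).Splits := by
  induction m with
  | zero => exact hf
  | succ m ih => rw [Function.iterate_succ_apply']; exact ih.derivative_real

namespace Multiset

theorem esymm_cons_succ {R : Type*} [CommSemiring R] (a : R) (s : Multiset R) (m : ℕ) :
    (a ::ₘ s).esymm (m + 1) = s.esymm (m + 1) + a * s.esymm m := by
  simp [esymm, powersetCard_cons, Multiset.sum_map_mul_left]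

theorem esymm_eq_zero_of_card_lt {R : Type*} [CommSemiring R] {s : Multiset R} {m : ℕ}
    (h : s.card < m) : s.esymm m = 0 := by
  simp [esymm, powersetCard_eq_empty m h]

theorem newton_esymm (s : Multiset ℝ) (j : ℕ) :
    ((j : ℝ) + 2) * ((s.card : ℝ) - j) * (s.esymm j * s.esymm (j + 2)) ≤
      ((j : ℝ) + 1) * ((s.card : ℝ) - j - 1) * s.esymm (j + 1) ^ 2 := by
  rcases lt_or_ge s.card (j + 1) with h | h
  · simp [esymm_eq_zero_of_card_lt h, esymm_eq_zero_of_card_lt (h.trans (Nat.lt_succ_self _))]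
  rcases h.eq_or_lt with h | h
  · rw [esymm_eq_zero_of_card_lt (show s.card < j + 2 by omega), ← h]
    simp
  obtain ⟨m, hm⟩ := Nat.exists_eq_add_of_lt h
  have hcard : s.card = m + (j + 2) := by omega
  set P := (s.map fun r => Polynomial.X + Polynomial.C r).prod with hP
  have hPs : P.Splits := Polynomial.Splits.multisetProd (by simp [Polynomial.Splits.X_add_C])
  have hPd : P.natDegree = m + (j + 2) := by
    rw [hP, natDegree_prod_X_add_C, hcard]
  have hc (i : ℕ) (hi : i ≤ j + 2) : P.coeff (i + m) = s.esymm (j + 2 - i) := by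
    rw [hP, Multiset.prod_X_add_C_coeff s (by omega)]
    congr 1
    omega
  have hd : (Polynomial.derivative^[m] P).natDegree = j + 2 := by
    refine le_antisymm ((Polynomial.natDegree_iterate_derivative P m).trans (by omega))
      (Polynomial.le_natDegree_of_ne_zero ?_)
    rw [Polynomial.coeff_iterate_derivative, hc _ le_rfl]
    simp [esymm, Nat.descFactorial_eq_zero_iff_lt]
  have key := (hPs.iterate_derivative_real m).laguerre
  rw [hd] at key
  simp only [Polynomial.coeff_iterate_derivative, nsmul_eq_mul] at key
  rw [hc 0 (by omega), hc 1 (by omega), hc 2 (by omega)] at key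
  have d0 : (0 + m).descFactorial m = m.factorial := by simp [Nat.descFactorial_self]
  have d1 : (1 + m).descFactorial m = (m + 1) * m.factorial := by
    have := Nat.factorial_mul_descFactorial (show m ≤ 1 + m by omega)
    simpa [add_comm 1 m, Nat.factorial_succ] using this
  have d2 : 2 * (2 + m).descFactorial m = (m + 2) * ((m + 1) * m.factorial) := by
    have := Nat.factorial_mul_descFactorial (show m ≤ 2 + m by omega)
    simpa [add_comm 2 m, Nat.factorial_succ] using this
  have d2' : 2 * (((2 + m).descFactorial m : ℕ) : ℝ) = (m + 2) * ((m + 1) * m.factorial) := by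
    exact_mod_cast d2
  rw [d0, d1] at key
  have hf : (0 : ℝ) < m.factorial := by positivity
  rw [hcard]
  simp only [Nat.sub_zero, Nat.add_sub_cancel, show j + 2 - 1 = j + 1 by omega] at key
  push_cast at key ⊢
  have hpos : (0 : ℝ) < (m + 1) * m.factorial ^ 2 := by positivity
  refine le_of_mul_le_mul_left ?_ hpos
  have e : 2 * ((j : ℝ) + 2) * (m.factorial * s.esymm (j + 2) *
      (((2 + m).descFactorial m : ℕ) * s.esymm j)) =
      ((j : ℝ) + 2) * (m.factorial * s.esymm (j + 2) *
      ((2 * (((2 + m).descFactorial m : ℕ) : ℝ)) * s.esymm j)) := by ring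
  rw [e, d2'] at key
  linarith

theorem esymm_mul_esymm_le_sq (s : Multiset ℝ) (j : ℕ) :
    s.esymm j * s.esymm (j + 2) ≤ s.esymm (j + 1) ^ 2 := by
  rcases lt_or_ge s.card (j + 2) with h | h
  · rw [esymm_eq_zero_of_card_lt h, mul_zero]
    positivity
  · have hN : (j : ℝ) + 2 ≤ s.card := by exact_mod_cast h
    have hj : (0 : ℝ) ≤ j := j.cast_nonneg
    refine le_of_mul_le_mul_left ((newton_esymm s j).trans ?_)
      (mul_pos (show (0 : ℝ) < j + 2 by linarith) (show (0 : ℝ) < s.card - j by linarith))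
    refine mul_le_mul_of_nonneg_right ?_ (sq_nonneg _)
    nlinarith

theorem esymm_zero' (s : Multiset ℝ) : s.esymm 0 = 1 := by simp [esymm]

theorem card_ge_of_esymm_pos {s : Multiset ℝ} {m : ℕ} (h : 0 < s.esymm m) : m ≤ s.card := by
  by_contra! hlt
  exact h.ne' (esymm_eq_zero_of_card_lt hlt)

theorem esymm_pos_of_cons {a : ℝ} {s : Multiset ℝ} {k : ℕ}
    (h : ∀ m ≤ k + 1, 0 < (a ::ₘ s).esymm m) : ∀ m ≤ k, 0 < s.esymm m := by
  intro m
  induction m with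
  | zero => simp [esymm_zero']
  | succ m ih =>
    intro hm
    have h0 := ih (by omega)
    have h1 := h (m + 1) (by omega)
    have h2 := h (m + 2) (by omega)
    rw [esymm_cons_succ] at h1 h2
    by_contra! hle
    have h3 := esymm_mul_esymm_le_sq s m
    nlinarith [mul_pos h0 h2, mul_nonneg (neg_nonneg.2 hle) h1.le]

theorem esymm_pos_of_nonpos_cons {a : ℝ} {s : Multiset ℝ} {k : ℕ} (ha : a ≤ 0)
    (h : ∀ m ≤ k, 0 < (a ::ₘ s).esymm m) : ∀ m ≤ k, 0 < s.esymm m := by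
  intro m
  induction m with
  | zero => simp [esymm_zero']
  | succ m ih =>
    intro hm
    have h0 := ih (by omega)
    have h1 := h (m + 1) hm
    rw [esymm_cons_succ] at h1
    nlinarith

theorem newton_maclaurin_esymm (s : Multiset ℝ) {i j : ℕ} (hij : i ≤ j)
    (h : ∀ m ≤ j + 1, 0 < s.esymm m) :
    ((j : ℝ) + 2) * ((s.card : ℝ) - i) * (s.esymm (j + 2) * s.esymm i) ≤
      ((i : ℝ) + 1) * ((s.card : ℝ) - j - 1) * (s.esymm (j + 1) * s.esymm (i + 1)) := by
  induction j, hij using Nat.le_induction with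
  | base => linarith [newton_esymm s i]
  | succ j hij ih =>
    have ih := ih fun m hm => h m (by omega)
    have hn := newton_esymm s (j + 1)
    have hN : (j : ℝ) + 2 ≤ s.card := by
      exact_mod_cast card_ge_of_esymm_pos (h (j + 2) le_rfl)
    have hi : (i : ℝ) ≤ j := by exact_mod_cast hij
    have p0 := h i (by omega)
    have p1 := h (j + 1) (by omega)
    have p2 := h (j + 2) (by omega)
    push_cast at hn ⊢
    simp only [add_assoc, Nat.reduceAdd] at *
    have hpos : 0 < ((s.card : ℝ) - j - 1) * s.esymm (j + 1) :=
      mul_pos (by linarith) p1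
    refine le_of_mul_le_mul_left ?_ hpos
    have t1 := mul_le_mul_of_nonneg_left hn
      (mul_nonneg (show (0 : ℝ) ≤ s.card - i by linarith) p0.le)
    have t2 := mul_le_mul_of_nonneg_left ih
      (mul_nonneg (show (0 : ℝ) ≤ s.card - j - 2 by linarith) p2.le)
    ring_nf at t1 t2 ⊢
    linarith

theorem le_esymm_cons_neg {a b ε : ℝ} {μ : Multiset ℝ} {m : ℕ} (ha : 0 < a) (hε0 : 0 < ε)
    (hε1 : ε ≤ 1) (hb : ε * a ≤ b) (h : ∀ j ≤ m + 1, 0 < (a ::ₘ -b ::ₘ μ).esymm j) :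
    ε ^ 2 / (4 * ((μ.card : ℝ) + 1)) * (a ::ₘ -b ::ₘ μ).esymm m ≤ (-b ::ₘ μ).esymm m := by
  have hb0 : 0 < b := (mul_pos hε0 ha).trans_le hb
  have hN0 : (0 : ℝ) ≤ μ.card := Nat.cast_nonneg _
  rcases m with _ | i
  · rw [esymm_zero', esymm_zero', mul_one, div_le_one (by positivity)]
    nlinarith
  have hμ : ∀ j ≤ i + 1, 0 < μ.esymm j := by
    refine esymm_pos_of_cons (a := a) (esymm_pos_of_nonpos_cons (neg_nonpos.2 hb0.le) ?_)
    rwa [cons_swap]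
  have hs := h (i + 2) le_rfl
  have hp := hμ (i + 1) le_rfl
  have hq := hμ i (by omega)
  have hNi : (i : ℝ) + 1 ≤ μ.card := by exact_mod_cast card_ge_of_esymm_pos hp
  have hi0 : (0 : ℝ) ≤ i := i.cast_nonneg
  have newton := newton_esymm μ i
  have hle : (-b ::ₘ μ).esymm i ≤ μ.esymm i := by
    rcases i with _ | i
    · simp [esymm_zero']
    · rw [esymm_cons_succ]
      have := mul_pos hb0 (hμ i (by omega))
      linarith
  rw [esymm_cons_succ, esymm_cons_succ, esymm_cons_succ] at hs
  rw [esymm_cons_succ a, esymm_cons_succ (-b)]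
  generalize (-b ::ₘ μ).esymm i = t at *
  generalize μ.esymm (i + 2) = s at *
  generalize μ.esymm (i + 1) = p at *
  generalize μ.esymm i = q at *
  generalize (μ.card : ℝ) = N at *
  generalize (i : ℝ) = x at *
  clear h hμ
  obtain ⟨H, hH⟩ : ∃ H : ℝ, H = 1 / (2 * (N + 1)) := ⟨_, rfl⟩
  have hH0 : 0 < H := by rw [hH]; positivity
  have hH2 : 2 * (N + 1) * H = 1 := by rw [hH]; field_simp
  have hH1 : H < 1 := by nlinarith
  have newton' : q * s ≤ (1 - 2 * H) * p ^ 2 := by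
    have hT : 0 < (x + 2) * (N - x) := by nlinarith
    refine le_of_mul_le_mul_left (newton.trans ?_) hT
    have : (x + 1) * (N - x - 1) ≤ (x + 2) * (N - x) * (1 - 2 * H) := by
      have hT2 : (x + 2) * (N - x) ≤ (N + 1) ^ 2 := by nlinarith
      have : (x + 2) * (N - x) * (2 * H) ≤ N + 1 := by
        calc _ ≤ (N + 1) ^ 2 * (2 * H) := by gcongr
          _ = (N + 1) * (2 * (N + 1) * H) := by ring
          _ = N + 1 := by rw [hH2, mul_one]
      nlinarith
    nlinarith [mul_le_mul_of_nonneg_right this (sq_nonneg p)]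
  have main : ε * H * p ≤ p - b * q := by
    rcases le_or_gt s ((1 - H) * (b * p)) with h1 | h1
    · refine le_of_mul_le_mul_left ?_ ha
      have := mul_le_mul_of_nonneg_right hb (mul_nonneg hH0.le hp.le)
      nlinarith
    · have h2 : (1 - H) * (b * q) ≤ (1 - 2 * H) * p := by
        refine le_of_mul_le_mul_left ?_ hp
        nlinarith [mul_le_mul_of_nonneg_left h1.le hq.le]
      have h3 : H * p ≤ p - b * q := by
        have h4 : H * p ≤ (1 - H) * (p - b * q) := by linarith
        have h5 : 0 < p - b * q := by
          have : 0 < (1 - H) * (p - b * q) := (mul_pos hH0 hp).trans_le h4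
          exact pos_of_mul_pos_right this (by linarith)
        nlinarith
      nlinarith [mul_pos hH0 hp]
  have hw : 0 < p - b * q := (by positivity : 0 < ε * H * p).trans_le main
  have h6 : ε * (a * t) ≤ p := by
    have : ε * a * t ≤ ε * a * q := by gcongr
    nlinarith [mul_le_mul_of_nonneg_right hb hq.le]
  have h7 : ε ^ 2 / (4 * (N + 1)) = ε ^ 2 * H / 2 := by rw [hH]; field_simp; norm_num
  rw [h7]
  have h8 : ε ^ 2 * H * (a * t) ≤ ε * H * p := by
    have := mul_le_mul_of_nonneg_left h6 (mul_pos hε0 hH0).le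
    nlinarith
  have h9 : ε ^ 2 * H ≤ 1 := by nlinarith
  nlinarith

end Multiset

theorem esymm_natCast {n : ℕ} (lam : Fin n → ℝ) (m : ℕ) :
    esymm lam (m : ℤ) = (univ.val.map lam).esymm m := by
  simp only [esymm, Finset.esymm_map_val]
  simp

theorem esymmDel_natCast {n : ℕ} (lam : Fin n → ℝ) (i : Fin n) (m : ℕ) :
    esymmDel lam i (m : ℤ) = ((univ.erase i).val.map lam).esymm m := by
  simp only [esymmDel, Finset.esymm_map_val]
  simp

theorem sum_esymmDel {n : ℕ} (lam : Fin n → ℝ) {m : ℕ} (hm : m ≤ n) :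
    ∑ i, esymmDel lam i (m : ℤ) = ((n : ℝ) - m) * esymm lam (m : ℤ) := by
  have h (i : Fin n) : esymmDel lam i (m : ℤ) =
      ∑ s ∈ powersetCard m univ, if i ∉ s then ∏ j ∈ s, lam j else 0 := by
    rw [← Finset.sum_filter]
    simp only [esymmDel, Int.toNat_natCast, Int.not_ofNat_neg, if_false]
    refine Finset.sum_congr ?_ fun _ _ => rfl
    ext s
    simp only [mem_powersetCard, mem_filter, subset_erase]
    tauto
  simp only [h]
  rw [Finset.sum_comm]
  simp only [esymm, Int.toNat_natCast, Int.not_ofNat_neg, if_false, Finset.mul_sum]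
  refine Finset.sum_congr rfl fun s hs => ?_
  have hc : (univ.filter fun i => i ∉ s).card = n - m := by
    rw [← compl_filter, card_compl, Fintype.card_fin]
    simp [(mem_powersetCard.1 hs).2]
  rw [← Finset.sum_filter, sum_const, hc, nsmul_eq_mul, Nat.cast_sub hm]

/-- Lemma 2.7, inequality (2.15): under the hypotheses of Lemma 2.7 and with
c₀ = min{ε²δ²/(2(n−2)(n−1)), ε²δ/(4(n−1))}, c₁ = (n/k)·((k−l)/(n−l))·c₀²/(n−k+1),
one has ∂[σ_k/σ_l]/∂λ₁ ≥ c₁ Σᵢ ∂[σ_k/σ_l]/∂λᵢ, written with the common positive factor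
σ_l(λ)² cleared. -/
theorem deriv_quotient_first_ge_c1 (n k l : ℕ) (hn : 3 ≤ n) (hk2 : 2 ≤ k)
    (hlk : l < k) (hkn : k ≤ n)
    (lam : Fin n → ℝ) (δ ε : ℝ) (hδ0 : 0 < δ) (hδ1 : δ ≤ 1) (hε0 : 0 < ε) (hε1 : ε ≤ 1)
    (hlam : lam ∈ GardingCone n k)
    (hsort : ∀ i j : Fin n, 1 ≤ (i : ℕ) → i ≤ j → lam j ≤ lam i)
    (h1pos : 0 < lam ⟨0, by omega⟩)
    (hnneg : lam ⟨n - 1, by omega⟩ < 0)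
    (hδlam : lam ⟨0, by omega⟩ ≥ δ * lam ⟨1, by omega⟩)
    (hεlam : -lam ⟨n - 1, by omega⟩ ≥ ε * lam ⟨0, by omega⟩) :
    esymmDel lam ⟨0, by omega⟩ ((k : ℤ) - 1) * esymm lam (l : ℤ)
      - esymm lam (k : ℤ) * esymmDel lam ⟨0, by omega⟩ ((l : ℤ) - 1)
    ≥ (((n : ℝ) / k) * (((k : ℝ) - l) / ((n : ℝ) - l)) *
        (min (ε ^ 2 * δ ^ 2 / (2 * ((n : ℝ) - 2) * ((n : ℝ) - 1)))
            (ε ^ 2 * δ / (4 * ((n : ℝ) - 1)))) ^ 2 / ((n : ℝ) - k + 1)) *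
      ∑ i : Fin n, (esymmDel lam i ((k : ℤ) - 1) * esymm lam (l : ℤ)
        - esymm lam (k : ℤ) * esymmDel lam i ((l : ℤ) - 1)) := by
  obtain ⟨j, rfl⟩ := Nat.exists_eq_add_of_le' hk2
  set z : Fin n := ⟨0, by omega⟩ with hz
  set w : Fin n := ⟨n - 1, by omega⟩ with hw
  have hcons (i : Fin n) : univ.val.map lam = lam i ::ₘ (univ.erase i).val.map lam := by
    rw [← Multiset.map_cons, Finset.erase_val, Multiset.cons_erase (Finset.mem_univ_val i)]
  have hpos : ∀ m ≤ j + 2, 0 < (univ.val.map lam).esymm m := by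
    intro m hm
    rcases Nat.eq_zero_or_pos m with rfl | h0
    · simp [Multiset.esymm_zero']
    · rw [← esymm_natCast]
      exact hlam m h0 hm
  have hdel (i : Fin n) : ∀ m ≤ j + 1, 0 < ((univ.erase i).val.map lam).esymm m :=
    Multiset.esymm_pos_of_cons (a := lam i) (by rwa [← hcons])
  have hwz : w ∈ univ.erase z := by
    simp only [mem_erase, mem_univ, and_true, hz, hw, ne_eq, Fin.mk.injEq]
    omega
  obtain ⟨μ, hμ⟩ : ∃ μ, μ = ((univ.erase z).erase w).val.map lam := ⟨_, rfl⟩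
  have hA : (univ.erase z).val.map lam = lam w ::ₘ μ := by
    rw [hμ, ← Multiset.map_cons, Finset.erase_val (univ.erase z), Multiset.cons_erase hwz]
  have hcardA : (((univ.erase z).val.map lam).card : ℝ) = n - 1 := by
    rw [Multiset.card_map, Finset.card_val, card_erase_of_mem (mem_univ z), card_univ,
      Fintype.card_fin, Nat.cast_sub (by omega), Nat.cast_one]
  have hcardμ : (μ.card : ℝ) + 1 = n - 1 := by
    rw [← hcardA, hA, Multiset.card_cons, Nat.cast_succ]
  have hn3 : (3 : ℝ) ≤ n := by exact_mod_cast hn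
  have hkn' : (j : ℝ) + 2 ≤ n := by exact_mod_cast hkn
  have hlk' : (l : ℝ) + 1 ≤ j + 2 := by exact_mod_cast hlk
  have hj0 : (0 : ℝ) ≤ j := j.cast_nonneg
  have hl0 : (0 : ℝ) ≤ l := l.cast_nonneg
  obtain ⟨c, hc⟩ : ∃ c, c = min (ε ^ 2 * δ ^ 2 / (2 * ((n : ℝ) - 2) * ((n : ℝ) - 1)))
      (ε ^ 2 * δ / (4 * ((n : ℝ) - 1))) := ⟨_, rfl⟩
  have hc0 : 0 ≤ c := by
    rw [hc]
    have h1 : (0 : ℝ) < n - 1 := by linarith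
    have h2 : (0 : ℝ) < n - 2 := by linarith
    positivity
  have hc1 : c ≤ ε ^ 2 / (4 * ((μ.card : ℝ) + 1)) := by
    rw [hc, hcardμ]
    refine (min_le_right _ _).trans ?_
    have h1 : (0 : ℝ) < n - 1 := by linarith
    gcongr
    exact mul_le_of_le_one_right (sq_nonneg ε) hδ1
  have hbound (m : ℕ) (hm : m ≤ j + 1) :
      c * (univ.val.map lam).esymm m ≤ ((univ.erase z).val.map lam).esymm m := by
    have h := Multiset.le_esymm_cons_neg (a := lam z) (b := -lam w) (μ := μ) (m := m) h1pos hε0 hε1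
      hεlam (by
        rw [neg_neg, ← hA, ← hcons]
        exact fun i hi => hpos i (by omega))
    rw [neg_neg, ← hA, ← hcons] at h
    exact (mul_le_mul_of_nonneg_right hc1 (hpos m (by omega)).le).trans h
  rw [← hc, show ((j + 2 : ℕ) : ℤ) - 1 = ((j + 1 : ℕ) : ℤ) by push_cast; ring]
  have hdel_nonneg (i : Fin n) : 0 ≤ esymmDel lam i ((l : ℤ) - 1) := by
    rcases l with _ | l
    · simp [esymmDel]
    · rw [show ((l + 1 : ℕ) : ℤ) - 1 = ((l : ℕ) : ℤ) by push_cast; ring, esymmDel_natCast]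
      exact (hdel i l (by omega)).le
  have hsum : ∑ i : Fin n, (esymmDel lam i ((j + 1 : ℕ) : ℤ) * esymm lam (l : ℤ)
        - esymm lam ((j + 2 : ℕ) : ℤ) * esymmDel lam i ((l : ℤ) - 1)) ≤
      ((n : ℝ) - (j + 2 : ℕ) + 1) *
        ((univ.val.map lam).esymm (j + 1) * (univ.val.map lam).esymm l) := by
    rw [Finset.sum_sub_distrib, ← Finset.sum_mul, sum_esymmDel lam (by omega)]
    have h1 : 0 ≤ ∑ i : Fin n, esymm lam ((j + 2 : ℕ) : ℤ) * esymmDel lam i ((l : ℤ) - 1) := by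
      refine Finset.sum_nonneg fun i _ => mul_nonneg ?_ (hdel_nonneg i)
      rw [esymm_natCast]
      exact (hpos _ le_rfl).le
    rw [esymm_natCast lam (j + 1), esymm_natCast lam l]
    push_cast at h1 ⊢
    linarith
  have hsplit (m : ℕ) : (univ.val.map lam).esymm (m + 1) =
      ((univ.erase z).val.map lam).esymm (m + 1) +
        lam z * ((univ.erase z).val.map lam).esymm m := by
    rw [hcons z, Multiset.esymm_cons_succ]
  obtain ⟨κ, hκ⟩ : ∃ κ : ℝ, κ = (n : ℝ) / (j + 2 : ℕ) * ((((j + 2 : ℕ) : ℝ) - l) / ((n : ℝ) - l)) :=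
    ⟨_, rfl⟩
  have hln : 0 < (n : ℝ) - l := by linarith
  have hκ0 : 0 ≤ κ := by
    rw [hκ]
    have : 0 ≤ ((j + 2 : ℕ) : ℝ) - l := by push_cast; linarith
    positivity
  have hfirst : κ * (((univ.erase z).val.map lam).esymm (j + 1) *
        ((univ.erase z).val.map lam).esymm l) ≤
      esymmDel lam z ((j + 1 : ℕ) : ℤ) * esymm lam (l : ℤ)
        - esymm lam ((j + 2 : ℕ) : ℤ) * esymmDel lam z ((l : ℤ) - 1) := by
    rw [esymmDel_natCast, esymm_natCast, esymm_natCast]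
    rcases l with _ | i
    · have : κ = 1 := by
        rw [hκ]
        have : (n : ℝ) ≠ 0 := by linarith
        rw [Nat.cast_zero, sub_zero, sub_zero]
        field_simp
      simp [this, esymmDel, Multiset.esymm_zero']
    · rw [show ((i + 1 : ℕ) : ℤ) - 1 = ((i : ℕ) : ℤ) by push_cast; ring, esymmDel_natCast,
        hsplit, hsplit]
      have h := Multiset.newton_maclaurin_esymm ((univ.erase z).val.map lam)
        (show i ≤ j by omega) (hdel z)
      rw [hcardA] at h
      have hκ' : ((j : ℝ) + 2) * (n - (i + 1)) * κ = n * (j + 2 - (i + 1)) := by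
        rw [hκ]
        push_cast at hln ⊢
        field_simp
      push_cast at hln
      have hT : 0 < ((j : ℝ) + 2) * (n - (i + 1)) := by positivity
      refine le_of_mul_le_mul_left ?_ hT
      rw [← mul_assoc, hκ']
      linarith
  have hcn : 0 < (n : ℝ) - (j + 2 : ℕ) + 1 := by push_cast; linarith
  rw [← hκ]
  calc _ ≤ κ * c ^ 2 / ((n : ℝ) - (j + 2 : ℕ) + 1) * (((n : ℝ) - (j + 2 : ℕ) + 1) *
        ((univ.val.map lam).esymm (j + 1) * (univ.val.map lam).esymm l)) :=
        mul_le_mul_of_nonneg_left hsum (by positivity)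
    _ = κ * ((c * (univ.val.map lam).esymm (j + 1)) * (c * (univ.val.map lam).esymm l)) := by
        field_simp
    _ ≤ κ * (((univ.erase z).val.map lam).esymm (j + 1) *
        ((univ.erase z).val.map lam).esymm l) := by
        refine mul_le_mul_of_nonneg_left (mul_le_mul (hbound _ le_rfl) (hbound _ (by omega)) ?_ ?_)
          hκ0
        · exact mul_nonneg hc0 (hpos l (by omega)).le
        · exact (hdel z _ le_rfl).le
    _ ≤ _ := hfirst
end

section
/- (Theorem 4.2, interior gradient bound away from the boundary.) Let 0 ≤ l < k ≤ n, μ > 0 and B_0, B_1 ≥ 0. There exists a constant M_1 > 0 depending only on n, k, l, μ, B_0 and B_1 with the following property: for every bounded open set Ω ⊂ ℝ^n, every positive function f ∈ C¹(Ω̄) with sup_Ω |Df| ≤ B_1, and every k-admissible solution u ∈ C³(Ω) of σ_k(D²u)/σ_l(D²u) = f(x) in Ω with sup_Ω |u| ≤ B_0, one has |Du(x)| ≤ M_1 for every x ∈ Ω whose distance to the boundary ∂Ω is at least μ. -/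
open Finset

/-- The Hessian matrix of u at x, with entries ∂²u/∂xᵢ∂xⱼ(x). -/
noncomputable def hessian {n : ℕ} (u : EuclideanSpace ℝ (Fin n) → ℝ)
    (x : EuclideanSpace ℝ (Fin n)) : Matrix (Fin n) (Fin n) ℝ :=
  fun i j =>
    fderiv ℝ (fun y => fderiv ℝ u y (EuclideanSpace.single j 1)) x
      (EuclideanSpace.single i 1)

/-- u is a k-admissible function at x: λ(D²u(x)) ∈ Γ_k, expressed through
σ_m(D²u(x)) = sum of the m×m principal minors of the (symmetric) Hessian,
which equals σ_m(λ(D²u(x))). -/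
def kAdmissibleAt {n : ℕ} (k : ℕ) (u : EuclideanSpace ℝ (Fin n) → ℝ)
    (x : EuclideanSpace ℝ (Fin n)) : Prop :=
  ∀ m : ℕ, 1 ≤ m → m ≤ k → 0 < sigmaMat (hessian u x) (m : ℤ)

open Polynomial in
theorem Polynomial.Splits.mul_derivative_derivative_le {p : ℝ[X]} (hp : p.Splits) (x : ℝ) :
    p.eval x * (derivative (derivative p)).eval x ≤ (derivative p).eval x ^ 2 := by
  induction hp using Submonoid.closure_induction with
  | mem p hp => obtain ⟨r, rfl⟩ | ⟨a, rfl⟩ := hp <;> simp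
  | one => simp
  | mul p q _ _ ihp ihq =>
    simp only [derivative_mul, derivative_add, eval_add, eval_mul]
    nlinarith [mul_le_mul_of_nonneg_left ihp (sq_nonneg (q.eval x)),
      mul_le_mul_of_nonneg_left ihq (sq_nonneg (p.eval x))]

open Polynomial in
theorem Polynomial.Splits.derivative_real_s16 {p : ℝ[X]} (hp : p.Splits) :
    (derivative p).Splits := by
  rw [splits_iff_card_roots] at hp ⊢
  have h1 := card_roots_le_derivative p
  have h2 := card_roots' (derivative p)
  have h3 := natDegree_derivative_le p
  by_cases h : p.natDegree = 0
  · rw [natDegree_eq_zero] at h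
    obtain ⟨c, rfl⟩ := h
    simp
  omega

/-- The elementary symmetric polynomial of degree `m` in the variables `x i`, `i ∈ S`;
it vanishes for `m < 0`. -/
noncomputable def esymmOn {ι : Type*} (S : Finset ι) (x : ι → ℝ) (m : ℤ) : ℝ :=
  if m < 0 then 0 else ∑ t ∈ Finset.powersetCard m.toNat S, ∏ i ∈ t, x i

section
variable {ι : Type*} {S : Finset ι} {x : ι → ℝ}

theorem esymmOn_natCast (S : Finset ι) (x : ι → ℝ) (m : ℕ) :
    esymmOn S x m = ∑ t ∈ Finset.powersetCard m S, ∏ i ∈ t, x i := by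
  simp [esymmOn]

theorem esymmOn_of_neg (S : Finset ι) (x : ι → ℝ) {m : ℤ} (hm : m < 0) : esymmOn S x m = 0 := by
  simp [esymmOn, hm]

@[simp] theorem esymmOn_zero (S : Finset ι) (x : ι → ℝ) : esymmOn S x 0 = 1 := by
  simp [esymmOn]

open Polynomial in
theorem eval_zero_iterate_derivative_prod (S : Finset ι) (x : ι → ℝ) {j : ℕ} (hj : j ≤ S.card) :
    (derivative^[j] (∏ i ∈ S, (X + C (x i)))).eval 0 = j.factorial * esymmOn S x (S.card - j : ℕ) := by
  rw [← coeff_zero_eq_eval_zero, coeff_iterate_derivative, zero_add, Finset.prod_X_add_C_coeff _ _ hj,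
    esymmOn_natCast, Nat.descFactorial_self, nsmul_eq_mul]

theorem esymmOn_newton (S : Finset ι) (x : ι → ℝ) {n : ℕ} (hn : S.card ≤ n) (m : ℤ) :
    esymmOn S x (m - 1) * esymmOn S x (m + 1) ≤ (1 - 1 / (n + 1)) * esymmOn S x m ^ 2 := by
  have hθ : (0:ℝ) ≤ 1 - 1 / (n + 1) := by
    rw [sub_nonneg, div_le_one (by positivity)]; linarith [(Nat.cast_nonneg n : (0:ℝ) ≤ n)]
  by_cases h0 : m < 1
  · rw [esymmOn_of_neg S x (show m - 1 < 0 by omega), zero_mul]; positivity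
  obtain ⟨k, rfl⟩ : ∃ k : ℕ, m = (k + 1 : ℕ) := ⟨(m - 1).toNat, by omega⟩
  rw [show ((k + 1 : ℕ) : ℤ) - 1 = (k : ℕ) by push_cast; ring,
    show ((k + 1 : ℕ) : ℤ) + 1 = (k + 2 : ℕ) by push_cast; ring]
  by_cases h1 : S.card < k + 2
  · have : esymmOn S x (k + 2 : ℕ) = 0 := by
      rw [esymmOn_natCast, Finset.powersetCard_eq_empty.2 h1, Finset.sum_empty]
    rw [this, mul_zero]; positivity
  push Not at h1
  set P : Polynomial ℝ := ∏ i ∈ S, (Polynomial.X + Polynomial.C (x i)) with hP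
  obtain ⟨j, hj⟩ := Nat.exists_eq_add_of_le h1
  have hs : ∀ j, (Polynomial.derivative^[j] P).Splits := by
    intro j
    induction j with
    | zero => exact Polynomial.Splits.prod fun i _ => Polynomial.Splits.X_add_C _
    | succ j ih => rw [Function.iterate_succ_apply']; exact ih.derivative_real_s16
  have key := (hs j).mul_derivative_derivative_le 0
  rw [← Function.iterate_succ_apply' Polynomial.derivative,
    ← Function.iterate_succ_apply' Polynomial.derivative,
    eval_zero_iterate_derivative_prod S x (by omega), eval_zero_iterate_derivative_prod S x (by omega),
    eval_zero_iterate_derivative_prod S x (by omega), show S.card - j = k + 2 by omega,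
    show S.card - (j + 1) = k + 1 by omega, show S.card - (j + 1 + 1) = k by omega] at key
  set a := esymmOn S x (k : ℕ)
  set b := esymmOn S x (k + 1 : ℕ)
  set c := esymmOn S x (k + 2 : ℕ)
  have hf : (0:ℝ) < j.factorial := by positivity
  simp only [Nat.factorial_succ, Nat.cast_mul] at key
  push_cast at key
  have key2 : (j + 2) * (a * c) ≤ (j + 1) * b ^ 2 := by
    have : 0 < (j.factorial : ℝ) ^ 2 * (j + 1) := by positivity
    nlinarith
  have hjn : (j : ℝ) + 1 ≤ n := by exact_mod_cast (by omega : j + 1 ≤ n)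
  have : a * c ≤ (1 - 1 / (j + 2)) * b ^ 2 := by
    rw [show (1 - 1 / ((j:ℝ) + 2)) = (j + 1) / (j + 2) by field_simp; ring, div_mul_eq_mul_div, le_div_iff₀ (by positivity)]
    linarith
  refine this.trans (mul_le_mul_of_nonneg_right ?_ (sq_nonneg b))
  have : 1 / ((n:ℝ) + 1) ≤ 1 / (j + 2) := by
    exact one_div_le_one_div_of_le (by positivity) (by linarith)
  linarith

variable [DecidableEq ι]

theorem esymmOn_eq_erase {i : ι} (hi : i ∈ S) (m : ℤ) :
    esymmOn S x m = esymmOn (S.erase i) x m + x i * esymmOn (S.erase i) x (m - 1) := by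
  obtain hm | rfl | hm := lt_trichotomy m 0
  · simp [esymmOn_of_neg, hm, show m - 1 < 0 by omega]
  · simp [esymmOn_of_neg]
  · obtain ⟨k, rfl⟩ : ∃ k : ℕ, m = (k + 1 : ℕ) := ⟨(m - 1).toNat, by omega⟩
    rw [show ((k + 1 : ℕ) : ℤ) - 1 = (k : ℕ) by push_cast; ring]
    simp only [esymmOn_natCast]
    conv_lhs => rw [← Finset.insert_erase hi]
    rw [Finset.powersetCard_succ_insert (Finset.notMem_erase i S), Finset.sum_union, Finset.sum_image, Finset.mul_sum]
    · congr 1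
      refine Finset.sum_congr rfl fun t ht => ?_
      rw [Finset.prod_insert]
      intro h
      exact Finset.notMem_erase i S ((Finset.mem_powersetCard.1 ht).1 h)
    · intro a ha b hb hab
      have ha' : i ∉ a := fun h => Finset.notMem_erase i S ((Finset.mem_powersetCard.1 ha).1 h)
      have hb' : i ∉ b := fun h => Finset.notMem_erase i S ((Finset.mem_powersetCard.1 hb).1 h)
      rw [← Finset.erase_insert ha', hab, Finset.erase_insert hb']
    · rw [Finset.disjoint_left]
      intro a ha ha'
      obtain ⟨b, hb, rfl⟩ := Finset.mem_image.1 ha'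
      exact Finset.notMem_erase i S ((Finset.mem_powersetCard.1 ha).1 (Finset.mem_insert_self i b))

theorem sum_esymmOn_erase (S : Finset ι) (x : ι → ℝ) (m : ℕ) :
    ∑ i ∈ S, esymmOn (S.erase i) x m = ((S.card : ℝ) - m) * esymmOn S x m := by
  simp only [esymmOn_natCast, Finset.mul_sum]
  rw [Finset.sum_comm' (t' := Finset.powersetCard m S) (s' := fun t => S \ t)]
  · refine Finset.sum_congr rfl fun t ht => ?_
    obtain ⟨h1, h2⟩ := Finset.mem_powersetCard.1 ht
    rw [Finset.sum_const, Finset.card_sdiff_of_subset h1, h2, nsmul_eq_mul, Nat.cast_sub]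
    rw [← h2]; exact Finset.card_le_card h1
  · intro i t
    simp only [Finset.mem_powersetCard, Finset.mem_sdiff, Finset.subset_erase]
    tauto

end

section Cone
variable {ι : Type*} {S : Finset ι} {x : ι → ℝ}

theorem Finset.sum_mul_sum_le_of_weights {w a b : ι → ℝ} (hw : ∀ i ∈ S, 0 ≤ w i)
    (hw1 : ∑ i ∈ S, w i = 1) (hab : ∀ i ∈ S, ∀ j ∈ S, 0 ≤ (a i - a j) * (b i - b j)) :
    (∑ i ∈ S, w i * a i) * (∑ i ∈ S, w i * b i) ≤ ∑ i ∈ S, w i * (a i * b i) := by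
  have h : 0 ≤ ∑ i ∈ S, ∑ j ∈ S, w i * w j * ((a i - a j) * (b i - b j)) :=
    Finset.sum_nonneg fun i hi => Finset.sum_nonneg fun j hj =>
      mul_nonneg (mul_nonneg (hw i hi) (hw j hj)) (hab i hi j hj)
  have e : ∀ i j, w i * w j * ((a i - a j) * (b i - b j)) =
      w i * (a i * b i) * w j - w i * a i * (w j * b j) - w i * b i * (w j * a j) +
        w i * (w j * (a j * b j)) := fun i j => by ring
  simp only [e, Finset.sum_add_distrib, Finset.sum_sub_distrib, ← Finset.mul_sum, ← Finset.sum_mul,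
    hw1] at h
  linarith

theorem esymmOn_mul_le {n : ℕ} (hn : S.card ≤ n) {l p : ℤ} (hl : 0 ≤ l) (hlp : l ≤ p)
    (h : ∀ m, 0 ≤ m → m ≤ p → 0 < esymmOn S x m) :
    esymmOn S x (p + 1) * esymmOn S x (l - 1) ≤
      (1 - 1 / (n + 1)) * (esymmOn S x l * esymmOn S x p) := by
  have hθ : (1:ℝ) - 1 / (n + 1) ≤ 1 := by
    have : (0:ℝ) ≤ 1 / ((n : ℝ) + 1) := by positivity
    linarith
  have hl' : 0 ≤ esymmOn S x (l - 1) := by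
    rcases hl.eq_or_lt with rfl | hl
    · rw [esymmOn_of_neg S x (by omega)]
    · exact (h _ (by omega) (by omega)).le
  induction p, hlp using Int.leInduction with
  | base => linarith [esymmOn_newton S x hn l]
  | succ p hp ih =>
    have ih := ih fun m hm hmp => h m hm (by omega)
    have h1 := h p (by omega) (by omega)
    have h2 := h (p + 1) (by omega) (by omega)
    have hN := esymmOn_newton S x hn (p + 1)
    rw [add_sub_cancel_right] at hN
    have hN' := hN.trans (mul_le_of_le_one_left (sq_nonneg _) hθ)
    refine le_of_mul_le_mul_left ?_ h1
    calc esymmOn S x p * (esymmOn S x (p + 1 + 1) * esymmOn S x (l - 1))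
        = (esymmOn S x p * esymmOn S x (p + 1 + 1)) * esymmOn S x (l - 1) := by ring
      _ ≤ esymmOn S x (p + 1) ^ 2 * esymmOn S x (l - 1) := by gcongr
      _ = esymmOn S x (p + 1) * (esymmOn S x (p + 1) * esymmOn S x (l - 1)) := by ring
      _ ≤ esymmOn S x (p + 1) * ((1 - 1 / (n + 1)) * (esymmOn S x l * esymmOn S x p)) := by gcongr
      _ = _ := by ring

variable [DecidableEq ι]

theorem esymmOn_erase_pos {k : ℤ} (h : ∀ m, 0 ≤ m → m ≤ k → 0 < esymmOn S x m) {i : ι}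
    (hi : i ∈ S) (m : ℤ) (hm : 0 ≤ m) (hmk : m ≤ k - 1) : 0 < esymmOn (S.erase i) x m := by
  induction m, hm using Int.leInduction with
  | base => simp
  | succ m hm ih =>
    have ih := ih (by omega)
    have h1 := h (m + 1) (by omega) (by omega)
    have h2 := h (m + 1 + 1) (by omega) (by omega)
    rw [esymmOn_eq_erase hi, add_sub_cancel_right] at h1 h2
    have hN := esymmOn_newton (S.erase i) x le_rfl (m + 1)
    rw [add_sub_cancel_right] at hN
    have hN' : esymmOn (S.erase i) x m * esymmOn (S.erase i) x (m + 1 + 1) ≤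
        esymmOn (S.erase i) x (m + 1) ^ 2 := by
      refine hN.trans (mul_le_of_le_one_left (sq_nonneg _) ?_)
      have : (0:ℝ) ≤ 1 / (((S.erase i).card : ℝ) + 1) := by positivity
      linarith
    by_contra! hneg
    generalize esymmOn (S.erase i) x m = a at *
    generalize esymmOn (S.erase i) x (m + 1) = b at *
    generalize esymmOn (S.erase i) x (m + 1 + 1) = c at *
    nlinarith [mul_pos ih h2]

/-- The diagonal entries of the linearization of `σ_k / σ_l`, multiplied by `σ_l ^ 2`. -/
noncomputable def quotientCoeff (S : Finset ι) (x : ι → ℝ) (k l : ℤ) (i : ι) : ℝ :=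
  esymmOn S x l * esymmOn (S.erase i) x (k - 1) - esymmOn S x k * esymmOn (S.erase i) x (l - 1)

theorem quotientCoeff_ge {k l : ℤ} (hl : 0 ≤ l) (hlk : l < k)
    (h : ∀ m, 0 ≤ m → m ≤ k → 0 < esymmOn S x m) {i : ι} (hi : i ∈ S) :
    1 / (S.card + 1 : ℝ) * (esymmOn (S.erase i) x l * esymmOn (S.erase i) x (k - 1)) ≤
      quotientCoeff S x k l i := by
  have key := esymmOn_mul_le (S := S.erase i) (x := x) (Finset.card_le_card (S.erase_subset i)) hl
    (show l ≤ k - 1 by omega) (esymmOn_erase_pos h hi)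
  rw [sub_add_cancel] at key
  rw [quotientCoeff, esymmOn_eq_erase hi l, esymmOn_eq_erase hi k]
  linarith

theorem sum_quotientCoeff_le {k l : ℤ} (hl : 0 ≤ l) (hlk : l < k)
    (h : ∀ m, 0 ≤ m → m ≤ k → 0 < esymmOn S x m) :
    ∑ i ∈ S, quotientCoeff S x k l i ≤ S.card * (esymmOn S x l * esymmOn S x (k - 1)) := by
  have h1 : ∀ i ∈ S, quotientCoeff S x k l i ≤
      esymmOn S x l * esymmOn (S.erase i) x (k - 1) := by
    intro i hi
    have : 0 ≤ esymmOn (S.erase i) x (l - 1) := by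
      rcases hl.eq_or_lt with rfl | hl
      · rw [esymmOn_of_neg _ x (by omega)]
      · exact (esymmOn_erase_pos h hi _ (by omega) (by omega)).le
    have := mul_nonneg (h k (by omega) le_rfl).le this
    rw [quotientCoeff]
    linarith
  refine (Finset.sum_le_sum h1).trans ?_
  obtain ⟨p, hp⟩ : ∃ p : ℕ, k - 1 = p := ⟨(k - 1).toNat, by omega⟩
  have h2 := h p (by omega) (by omega)
  have h3 := h l hl hlk.le
  rw [← Finset.mul_sum, hp, sum_esymmOn_erase]
  have := mul_nonneg (mul_nonneg h3.le h2.le) (Nat.cast_nonneg (α := ℝ) p)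
  linarith

theorem esymmOn_erase_sub {i j : ι} (hi : i ∈ S) (hj : j ∈ S) (hij : i ≠ j) (m : ℤ) :
    esymmOn (S.erase i) x m - esymmOn (S.erase j) x m =
      -((x i - x j) * esymmOn ((S.erase i).erase j) x (m - 1)) := by
  rw [esymmOn_eq_erase (Finset.mem_erase.2 ⟨hij.symm, hj⟩) m,
    esymmOn_eq_erase (Finset.mem_erase.2 ⟨hij, hi⟩) m, Finset.erase_right_comm]
  ring

theorem esymmOn_erase_erase_nonneg {k : ℤ} (h : ∀ m, 0 ≤ m → m ≤ k → 0 < esymmOn S x m) {i j : ι}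
    (hi : i ∈ S) (hj : j ∈ S) (hij : i ≠ j) {m : ℤ} (hmk : m ≤ k - 2) :
    0 ≤ esymmOn ((S.erase i).erase j) x m := by
  by_cases hm : m < 0
  · rw [esymmOn_of_neg _ x hm]
  · exact (esymmOn_erase_pos (esymmOn_erase_pos h hi) (Finset.mem_erase.2 ⟨hij.symm, hj⟩) m
      (by omega) (by omega)).le

theorem sum_mul_quotientCoeff_ge {k l : ℤ} (hl : 0 ≤ l) (hlk : l < k)
    (h : ∀ m, 0 ≤ m → m ≤ k → 0 < esymmOn S x m) {w : ι → ℝ} (hw : ∀ i ∈ S, 0 ≤ w i)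
    (hw1 : ∑ i ∈ S, w i = 1) (hwx : ∑ i ∈ S, w i * x i ≤ -1) :
    1 / (S.card + 1 : ℝ) * (esymmOn S x l * esymmOn S x (k - 1)) ≤
        ∑ i ∈ S, w i * quotientCoeff S x k l i ∧
      1 / (S.card + 1 : ℝ) * esymmOn S x l ^ 2 ≤ ∑ i ∈ S, w i * quotientCoeff S x k l i := by
  set s : ℤ → ℝ := fun m => ∑ i ∈ S, w i * esymmOn (S.erase i) x m with hs
  have hs0 : ∀ m ≤ k - 1, 0 ≤ s m := by
    intro m hm
    refine Finset.sum_nonneg fun i hi => mul_nonneg (hw i hi) ?_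
    by_cases hm0 : m < 0
    · rw [esymmOn_of_neg _ x hm0]
    · exact (esymmOn_erase_pos h hi m (by omega) hm).le
  have hstep : ∀ m ≤ k - 1, esymmOn S x m + s (m - 1) ≤ s m := by
    intro m hm
    have h1 : (∑ i ∈ S, w i * -x i) * (∑ i ∈ S, w i * esymmOn (S.erase i) x (m - 1)) ≤
        ∑ i ∈ S, w i * (-x i * esymmOn (S.erase i) x (m - 1)) := by
      refine Finset.sum_mul_sum_le_of_weights hw hw1 fun i hi j hj => ?_
      by_cases hij : i = j
      · simp [hij]
      rw [esymmOn_erase_sub hi hj hij]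
      have := esymmOn_erase_erase_nonneg h hi hj hij (m := m - 1 - 1) (by omega)
      have := mul_nonneg (sq_nonneg (x i - x j)) this
      linarith
    have h2 : esymmOn S x m = s m + ∑ i ∈ S, w i * (x i * esymmOn (S.erase i) x (m - 1)) := by
      rw [hs, ← Finset.sum_add_distrib, ← one_mul (esymmOn S x m), ← hw1, Finset.sum_mul]
      refine Finset.sum_congr rfl fun i hi => ?_
      rw [esymmOn_eq_erase hi m]; ring
    simp only [mul_neg, neg_mul, Finset.sum_neg_distrib] at h1
    have := hs0 (m - 1) (by omega)
    change -(_ * s (m - 1)) ≤ _ at h1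
    have h3 : s (m - 1) ≤ -((∑ i ∈ S, w i * x i) * s (m - 1)) := by nlinarith
    linarith
  have hsge : ∀ m, 0 ≤ m → m ≤ k - 1 → esymmOn S x m ≤ s m := fun m hm hmk => by
    linarith [hstep m hmk, hs0 (m - 1) (by omega)]
  have hmono : ∀ m, l ≤ m → m ≤ k - 1 → s l ≤ s m := by
    intro m hm
    induction m, hm using Int.leInduction with
    | base => intro _; rfl
    | succ m hm ih =>
      intro hmk
      have h1 := hstep (m + 1) hmk
      rw [add_sub_cancel_right] at h1
      linarith [h (m + 1) (by omega) (by omega), ih (by omega)]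
  have hmain : 1 / (S.card + 1 : ℝ) * (s l * s (k - 1)) ≤ ∑ i ∈ S, w i * quotientCoeff S x k l i := by
    have h1 : s l * s (k - 1) ≤
        ∑ i ∈ S, w i * (esymmOn (S.erase i) x l * esymmOn (S.erase i) x (k - 1)) := by
      refine Finset.sum_mul_sum_le_of_weights hw hw1 fun i hi j hj => ?_
      by_cases hij : i = j
      · simp [hij]
      rw [esymmOn_erase_sub hi hj hij, esymmOn_erase_sub hi hj hij]
      have h1 := esymmOn_erase_erase_nonneg h hi hj hij (m := l - 1) (by omega)
      have h2 := esymmOn_erase_erase_nonneg h hi hj hij (m := k - 1 - 1) (by omega)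
      have := mul_nonneg (sq_nonneg (x i - x j)) (mul_nonneg h1 h2)
      linarith
    refine (mul_le_mul_of_nonneg_left h1 (by positivity)).trans ?_
    rw [Finset.mul_sum]
    refine Finset.sum_le_sum fun i hi => ?_
    have := mul_le_mul_of_nonneg_left (quotientCoeff_ge hl hlk h hi) (hw i hi)
    linarith
  have hl0 := h l hl hlk.le
  have hl1 := hsge l hl (by omega)
  have hk0 := h (k - 1) (by omega) (by omega)
  have hk1 := hsge (k - 1) (by omega) le_rfl
  have hsl := hs0 l (by omega)
  refine ⟨le_trans ?_ hmain, le_trans ?_ hmain⟩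
  · gcongr
  · rw [sq]
    have := hl1.trans (hmono (k - 1) (by omega) le_rfl)
    gcongr
end Cone

section Maximum

theorem IsLocalMax.deriv_eq_zero_and_second_deriv_nonpos {G G₁ : ℝ → ℝ} {G₂ a : ℝ}
    (hmax : IsLocalMax G a) (h₁ : ∀ᶠ t in nhds a, HasDerivAt G (G₁ t) t)
    (h₂ : HasDerivAt G₁ G₂ a) : G₁ a = 0 ∧ G₂ ≤ 0 := by
  have h0 : G₁ a = 0 := hmax.hasDerivAt_eq_zero h₁.self_of_nhds
  refine ⟨h0, ?_⟩
  by_contra! hpos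
  have hd : deriv G =ᶠ[nhds a] G₁ := h₁.mono fun t ht => ht.deriv
  have hdd : deriv (deriv G) a = G₂ := by rw [hd.deriv_eq, h₂.deriv]
  have hmin := isLocalMin_of_deriv_deriv_pos (by rw [hdd]; exact hpos)
    (by rw [hd.self_of_nhds, h0]) h₁.self_of_nhds.continuousAt
  have hc : G =ᶠ[nhds a] fun _ => G a := by
    filter_upwards [hmax, hmin] with t h1 h2 using le_antisymm h1 h2
  have hz : deriv G =ᶠ[nhds a] fun _ => 0 := by
    filter_upwards [hc.deriv] with t ht
    rw [ht, deriv_const]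
  rw [hz.deriv_eq, deriv_const] at hdd
  linarith

theorem IsLocalMax.log_conditions {v v₁ r r₁ D D₁ : ℝ → ℝ} {v₂ r₂ D₂ a : ℝ}
    (hmax : IsLocalMax (fun t => 2 * Real.log (v t) + 4 * Real.log (r t) - Real.log (D t)) a)
    (hv : ∀ᶠ t in nhds a, HasDerivAt v (v₁ t) t) (hr : ∀ᶠ t in nhds a, HasDerivAt r (r₁ t) t)
    (hD : ∀ᶠ t in nhds a, HasDerivAt D (D₁ t) t) (hv₁ : HasDerivAt v₁ v₂ a)
    (hr₁ : HasDerivAt r₁ r₂ a) (hD₁ : HasDerivAt D₁ D₂ a)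
    (hv0 : 0 < v a) (hr0 : 0 < r a) (hD0 : 0 < D a) :
    2 * (v₁ a / v a) + 4 * (r₁ a / r a) - D₁ a / D a = 0 ∧
      2 * ((v₂ * v a - v₁ a * v₁ a) / v a ^ 2) + 4 * ((r₂ * r a - r₁ a * r₁ a) / r a ^ 2) -
        (D₂ * D a - D₁ a * D₁ a) / D a ^ 2 ≤ 0 := by
  refine hmax.deriv_eq_zero_and_second_deriv_nonpos
    (G₁ := fun t => 2 * (v₁ t / v t) + 4 * (r₁ t / r t) - D₁ t / D t) ?_ ?_
  · filter_upwards [hv, hr, hD, hv.self_of_nhds.continuousAt.eventually_ne hv0.ne',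
      hr.self_of_nhds.continuousAt.eventually_ne hr0.ne',
      hD.self_of_nhds.continuousAt.eventually_ne hD0.ne'] with t h1 h2 h3 h4 h5 h6
    exact (((h1.log h4).const_mul 2).add ((h2.log h5).const_mul 4)).sub (h3.log h6)
  · exact (((hv₁.div hv.self_of_nhds hv0.ne').const_mul 2).add
      ((hr₁.div hr.self_of_nhds hr0.ne').const_mul 4)).sub (hD₁.div hD.self_of_nhds hD0.ne')

theorem second_order_bound {x u T ρ p r D R : ℝ} (hp : 0 < p) (hr : 0 < r) (hrR : r ≤ R ^ 2)
    (hD : 1 ≤ D) (hu : u ^ 2 ≤ p ^ 2) (hρ : ρ ^ 2 ≤ (2 * R) ^ 2)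
    (b : x * u / p ^ 2 = -(ρ / r + u / (4 * D)))
    (a : 2 * (((2 * x ^ 2 + 2 * T) * p ^ 2 - 2 * (x * u) * (2 * (x * u))) / (p ^ 2) ^ 2) +
      4 * ((-2 * r - ρ * ρ) / r ^ 2) + (x * D + u * u) / D ^ 2 ≤ 0) :
    T / p ^ 2 + x / (4 * D) + u ^ 2 / (8 * D ^ 2) ≤ 14 * R ^ 2 / r ^ 2 := by
  have e1 : 2 * (((2 * x ^ 2 + 2 * T) * p ^ 2 - 2 * (x * u) * (2 * (x * u))) /
      (p ^ 2) ^ 2) = 4 * (x ^ 2 / p ^ 2 + T / p ^ 2 - 2 * (x * u / p ^ 2) ^ 2) := by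
    field_simp; ring
  have e2 : 4 * ((-2 * r - ρ * ρ) / r ^ 2) = 4 * (-(2 / r) - (ρ / r) ^ 2) := by
    field_simp
  have e3 : (x * D + u * u) / D ^ 2 = 4 * (x / (4 * D)) + 4 * (u / (2 * D)) ^ 2 := by
    field_simp; ring
  have e4 : u ^ 2 / (8 * D ^ 2) = 2 * (u / (4 * D)) ^ 2 := by
    rw [div_pow, mul_pow, ← mul_div_assoc, div_eq_div_iff (by positivity) (by positivity)]; ring
  have e5 : u / (2 * D) = 2 * (u / (4 * D)) := by field_simp; norm_num
  have e6 : (x * u / p ^ 2) ^ 2 ≤ x ^ 2 / p ^ 2 := by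
    rw [div_pow, div_le_div_iff₀ (by positivity) (by positivity)]
    have := mul_le_mul_of_nonneg_left hu (mul_nonneg (sq_nonneg (x)) (sq_nonneg p))
    linarith
  have e7 : (ρ / r) ^ 2 ≤ 4 * (R ^ 2 / r ^ 2) := by
    rw [div_pow, ← mul_div_assoc]
    gcongr; linarith
  have e8 : 2 / r ≤ 2 * (R ^ 2 / r ^ 2) := by
    rw [← mul_div_assoc, div_le_div_iff₀ hr (by positivity)]
    have := mul_le_mul_of_nonneg_left hrR hr.le
    linarith
  rw [e1, e2, e3, e5] at a
  rw [e4, mul_div_assoc 14]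
  have e9 : (x * u / p ^ 2) ^ 2 ≤ 2 * (ρ / r) ^ 2 + 2 * (u / (4 * D)) ^ 2 := by
    rw [b]; nlinarith [sq_nonneg (ρ / r - u / (4 * D))]
  nlinarith

variable {ι : Type*} [DecidableEq ι]

theorem sum_mul_esymmOn_erase (S : Finset ι) (x : ι → ℝ) (m : ℕ) :
    ∑ i ∈ S, x i * esymmOn (S.erase i) x ((m : ℤ) - 1) = m * esymmOn S x m := by
  have h := sum_esymmOn_erase S x m
  have : ∑ i ∈ S, esymmOn S x m = ∑ i ∈ S, (esymmOn (S.erase i) x m +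
      x i * esymmOn (S.erase i) x ((m : ℤ) - 1)) :=
    Finset.sum_congr rfl fun i hi => esymmOn_eq_erase hi m
  rw [Finset.sum_const, nsmul_eq_mul, Finset.sum_add_distrib, h] at this
  linarith

theorem sum_mul_quotientCoeff (S : Finset ι) (x : ι → ℝ) (k l : ℕ) :
    ∑ i ∈ S, quotientCoeff S x k l i * x i = (k - l) * (esymmOn S x k * esymmOn S x l) := by
  have e : ∀ i, quotientCoeff S x k l i * x i =
      esymmOn S x l * (x i * esymmOn (S.erase i) x ((k : ℤ) - 1)) -
        esymmOn S x k * (x i * esymmOn (S.erase i) x ((l : ℤ) - 1)) := fun i => by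
    rw [quotientCoeff]; ring
  simp only [e, Finset.sum_sub_distrib, ← Finset.mul_sum, sum_mul_esymmOn_erase]
  ring

set_option maxHeartbeats 1000000 in
theorem critical_point_bound {S : Finset ι} {x u T ρ : ι → ℝ} {k l : ℕ} (hlk : l < k)
    (h : ∀ m : ℤ, 0 ≤ m → m ≤ k → 0 < esymmOn S x m)
    {p r D E R B φ : ℝ} (hp : 0 < p) (hpu : ∑ i ∈ S, u i ^ 2 = p ^ 2)
    (hr : 0 < r) (hrR : r ≤ R ^ 2) (hR : 0 < R) (hD : 1 ≤ D) (hDE : D ≤ E) (hB : 0 ≤ B)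
    (hρ : ∑ i ∈ S, ρ i ^ 2 ≤ (2 * R) ^ 2)
    (h₁ : ∀ i ∈ S, 2 * (2 * (x i * u i) / p ^ 2) + 4 * (ρ i / r) + u i / D = 0)
    (h₂ : ∀ i ∈ S, 2 * (((2 * x i ^ 2 + 2 * T i) * p ^ 2 - 2 * (x i * u i) * (2 * (x i * u i))) /
      (p ^ 2) ^ 2) + 4 * ((-2 * r - ρ i * ρ i) / r ^ 2) + (x i * D + u i * u i) / D ^ 2 ≤ 0)
    (hT : ∑ i ∈ S, quotientCoeff S x k l i * T i = esymmOn S x l ^ 2 * φ) (hφ : |φ| ≤ B * p) :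
    p * r ≤ 8 * E * R ^ 2 + 16 * E * R +
      8 * E ^ 2 * (S.card + 1) * (B * R ^ 4 + 14 * R ^ 2 * S.card) + 1 := by
  have hE : 1 ≤ E := hD.trans hDE
  have hQ : 0 ≤ 8 * E ^ 2 * (S.card + 1) * (B * R ^ 4 + 14 * R ^ 2 * S.card) := by positivity
  by_cases hp1 : p ≤ 8 * E
  · have : p * r ≤ 8 * E * R ^ 2 := by gcongr
    have : 0 ≤ 16 * E * R := by positivity
    linarith
  push Not at hp1
  by_cases hp2 : p * r ≤ 16 * E * R
  · have : 0 ≤ 8 * E * R ^ 2 := by positivity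
    linarith
  push Not at hp2
  -- first-order condition
  have h1 : ∀ i ∈ S, x i * u i / p ^ 2 = -(ρ i / r + u i / (4 * D)) := by
    intro i hi
    have := h₁ i hi
    have e1 : 2 * (x i * u i) / p ^ 2 = 2 * (x i * u i / p ^ 2) := by ring
    have e2 : u i / (4 * D) = u i / D / 4 := by field_simp
    rw [e1] at this
    rw [e2]; linarith
  have hwx : ∑ i ∈ S, u i ^ 2 / p ^ 2 * x i ≤ -1 := by
    have e : ∑ i ∈ S, u i ^ 2 / p ^ 2 * x i = -(∑ i ∈ S, ρ i * u i) / r - p ^ 2 / (4 * D) := by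
      rw [← hpu, neg_div, Finset.sum_div, Finset.sum_div, ← Finset.sum_neg_distrib,
        ← Finset.sum_sub_distrib]
      refine Finset.sum_congr rfl fun i hi => ?_
      rw [hpu]
      have := h1 i hi
      calc u i ^ 2 / p ^ 2 * x i = u i * (x i * u i / p ^ 2) := by ring
        _ = _ := by rw [this]; ring
    have hcs : -(∑ i ∈ S, ρ i * u i) ≤ 2 * R * p := by
      have := Finset.sum_mul_sq_le_sq_mul_sq S ρ u
      rw [hpu] at this
      refine (neg_le_abs _).trans (abs_le_of_sq_le_sq ?_ (by positivity))
      rw [mul_pow]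
      exact this.trans (by gcongr)
    have a1 : -(∑ i ∈ S, ρ i * u i) / r ≤ p ^ 2 / (8 * E) := by
      rw [div_le_div_iff₀ hr (by positivity)]
      calc _ ≤ 2 * R * p * (8 * E) := by gcongr
        _ = p * (16 * E * R) := by ring
        _ ≤ p * (p * r) := by gcongr
        _ = _ := by ring
    have a2 : p ^ 2 / (4 * E) ≤ p ^ 2 / (4 * D) := by gcongr
    have a3 : p ^ 2 / (4 * E) = 2 * (p ^ 2 / (8 * E)) := by field_simp; norm_num
    have a4 : 1 ≤ p ^ 2 / (8 * E) := by
      rw [le_div_iff₀ (by positivity)]; nlinarith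
    rw [e]; linarith
  have hw1 : ∑ i ∈ S, u i ^ 2 / p ^ 2 = 1 := by
    rw [← Finset.sum_div, hpu, div_self (by positivity)]
  obtain ⟨hK1, hK2⟩ := sum_mul_quotientCoeff_ge (S := S) (x := x) (k := k) (l := l) (by omega)
    (by omega) h (fun i _ => by positivity) hw1 hwx
  have hg : ∀ i ∈ S, 0 ≤ quotientCoeff S x k l i := fun i hi =>
    le_trans (mul_nonneg (by positivity) (mul_nonneg
      (esymmOn_erase_pos h hi _ (by omega) (by omega)).le
      (esymmOn_erase_pos h hi _ (by omega) (by omega)).le))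
      (quotientCoeff_ge (k := k) (l := l) (by omega) (by omega) h hi)
  have hgs := sum_quotientCoeff_le (k := k) (l := l) (by omega) (by omega) h
  set K := ∑ i ∈ S, u i ^ 2 / p ^ 2 * quotientCoeff S x k l i with hK
  set g := quotientCoeff S x k l
  have hσl := h l (by omega) (by omega)
  have hσk := h k (by omega) (by omega)
  have hK0 : 0 < K := lt_of_lt_of_le (by positivity) hK2
  -- second-order condition
  have h2 : ∀ i ∈ S, T i / p ^ 2 + x i / (4 * D) + u i ^ 2 / (8 * D ^ 2) ≤ 14 * R ^ 2 / r ^ 2 :=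
    fun i hi => second_order_bound hp hr hrR hD
      (hpu ▸ Finset.single_le_sum (fun j _ => sq_nonneg (u j)) hi)
      ((Finset.single_le_sum (fun j _ => sq_nonneg (ρ j)) hi).trans hρ) (h1 i hi) (h₂ i hi)
  have h3 : esymmOn S x l ^ 2 * φ / p ^ 2 + p ^ 2 * K / (8 * D ^ 2) ≤
      14 * R ^ 2 / r ^ 2 * ∑ i ∈ S, g i := by
    have s1 := Finset.sum_le_sum fun i hi => mul_le_mul_of_nonneg_left (h2 i hi) (hg i hi)
    have s2 := sum_mul_quotientCoeff S x k l
    have e1 : ∑ i ∈ S, g i * (T i / p ^ 2 + x i / (4 * D) + u i ^ 2 / (8 * D ^ 2)) =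
        (∑ i ∈ S, g i * T i) / p ^ 2 + (∑ i ∈ S, g i * x i) / (4 * D) +
          p ^ 2 * K / (8 * D ^ 2) := by
      rw [hK, Finset.mul_sum, Finset.sum_div, Finset.sum_div, Finset.sum_div,
        ← Finset.sum_add_distrib, ← Finset.sum_add_distrib]
      refine Finset.sum_congr rfl fun i hi => ?_
      field_simp
    rw [e1, hT, s2, ← Finset.sum_mul] at s1
    have hkl : (l : ℝ) ≤ k := by exact_mod_cast hlk.le
    have : 0 ≤ ((k : ℝ) - l) * (esymmOn S x k * esymmOn S x l) / (4 * D) :=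
      div_nonneg (mul_nonneg (by linarith) (mul_pos hσk hσl).le) (by positivity)
    linarith
  set N : ℝ := (S.card : ℝ)
  have hN : 0 ≤ N := Nat.cast_nonneg _
  have hK1' : esymmOn S x l * esymmOn S x (k - 1) ≤ (N + 1) * K := by
    rw [one_div_mul_eq_div, div_le_iff₀ (by positivity)] at hK1; linarith
  have hK2' : esymmOn S x l ^ 2 ≤ (N + 1) * K := by
    rw [one_div_mul_eq_div, div_le_iff₀ (by positivity)] at hK2; linarith
  have h4 : p ^ 2 * K / (8 * E ^ 2) ≤
      14 * R ^ 2 / r ^ 2 * (N * ((N + 1) * K)) + (N + 1) * K * B := by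
    have b1 : p ^ 2 * K / (8 * E ^ 2) ≤ p ^ 2 * K / (8 * D ^ 2) := by gcongr
    have b2 : 14 * R ^ 2 / r ^ 2 * ∑ i ∈ S, g i ≤ 14 * R ^ 2 / r ^ 2 * (N * ((N + 1) * K)) := by
      gcongr
      exact hgs.trans (by gcongr)
    have b3 : -(esymmOn S x l ^ 2 * φ / p ^ 2) ≤ (N + 1) * K * B := by
      rw [mul_div_assoc, ← mul_neg, ← neg_div]
      have : -φ / p ^ 2 ≤ B := by
        rw [div_le_iff₀ (by positivity)]
        have := (neg_le_abs φ).trans hφ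
        have : B * p ≤ B * p ^ 2 := by gcongr; nlinarith
        linarith
      exact (mul_le_mul_of_nonneg_left this (sq_nonneg _)).trans (by gcongr)
    linarith
  have h5 : (p * r) ^ 2 ≤ 8 * E ^ 2 * (N + 1) * (B * R ^ 4 + 14 * R ^ 2 * N) := by
    have e1 : p ^ 2 / (8 * E ^ 2) ≤ 14 * R ^ 2 / r ^ 2 * (N * (N + 1)) + (N + 1) * B := by
      refine le_of_mul_le_mul_right ?_ hK0
      calc _ = p ^ 2 * K / (8 * E ^ 2) := by ring
        _ ≤ _ := h4
        _ = _ := by ring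
    rw [div_le_iff₀ (by positivity)] at e1
    calc (p * r) ^ 2 = p ^ 2 * r ^ 2 := by ring
      _ ≤ (14 * R ^ 2 / r ^ 2 * (N * (N + 1)) + (N + 1) * B) * (8 * E ^ 2) * r ^ 2 := by gcongr
      _ = 8 * E ^ 2 * (N + 1) * (B * r ^ 2 + 14 * R ^ 2 * N) := by field_simp; ring
      _ ≤ 8 * E ^ 2 * (N + 1) * (B * (R ^ 2) ^ 2 + 14 * R ^ 2 * N) := by gcongr
      _ = _ := by ring
  have : 0 ≤ 8 * E * R ^ 2 + 16 * E * R := by positivity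
  nlinarith [sq_nonneg (p * r - 1)]
end Maximum

section Minors

theorem hasDerivAt_det_of_diagonal {κ : Type*} [Fintype κ] [DecidableEq κ]
    {A : ℝ → Matrix κ κ ℝ} {A' : Matrix κ κ ℝ} {lam : κ → ℝ} {a : ℝ}
    (hA : ∀ i j, HasDerivAt (fun t => A t i j) (A' i j) a) (h0 : A a = Matrix.diagonal lam) :
    HasDerivAt (fun t => (A t).det) (∑ i, (∏ j ∈ univ.erase i, lam j) * A' i i) a := by
  have h1 : HasDerivAt (fun t => (A t).det)
      (∑ σ : Equiv.Perm κ, ((Equiv.Perm.sign σ : ℤ) : ℝ) *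
        ∑ i, (∏ j ∈ univ.erase i, A a (σ j) j) • A' (σ i) i) a := by
    simp only [Matrix.det_apply']
    exact HasDerivAt.fun_sum fun σ _ =>
      (HasDerivAt.fun_finsetProd fun i _ => hA (σ i) i).const_mul _
  convert h1 using 1
  rw [Finset.sum_eq_single_of_mem (1 : Equiv.Perm κ) (mem_univ _)]
  · simp [h0]
  · intro σ _ hσ
    refine mul_eq_zero_of_right _ (Finset.sum_eq_zero fun i _ => ?_)
    have : ∃ j, j ≠ i ∧ σ j ≠ j := by
      by_contra! hc
      refine hσ (Equiv.ext fun j => ?_)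
      by_cases hj : j = i
      · subst hj
        by_contra hne
        exact hne (σ.injective (hc (σ j) hne))
      · exact hc j hj
    obtain ⟨j, hji, hj⟩ := this
    rw [Finset.prod_eq_zero (mem_erase.2 ⟨hji, mem_univ j⟩), zero_smul]
    rw [h0, Matrix.diagonal_apply_ne _ hj]

theorem sum_powersetCard_prod_erase {ι : Type*} [DecidableEq ι] (S : Finset ι) (x y : ι → ℝ)
    (m : ℕ) :
    ∑ s ∈ powersetCard m S, ∑ i ∈ s, (∏ j ∈ s.erase i, x j) * y i =
      ∑ i ∈ S, esymmOn (S.erase i) x (m - 1) * y i := by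
  rcases m with _ | m
  · simp [esymmOn_of_neg]
  have : ∀ i, esymmOn (S.erase i) x ((m + 1 : ℕ) - 1) =
      ∑ t ∈ powersetCard m (S.erase i), ∏ j ∈ t, x j := fun i => by
    rw [show (((m + 1 : ℕ) : ℤ) - 1) = (m : ℕ) by push_cast; ring, esymmOn_natCast]
  simp only [this, Finset.sum_mul]
  rw [Finset.sum_sigma', Finset.sum_sigma']
  refine Finset.sum_bij' (fun p _ => ⟨p.2, p.1.erase p.2⟩) (fun p _ => ⟨insert p.1 p.2, p.1⟩)
    ?_ ?_ ?_ ?_ ?_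
  · rintro ⟨s, i⟩ h
    simp only [mem_sigma, mem_powersetCard] at h ⊢
    exact ⟨h.1.1 h.2, erase_subset_erase _ h.1.1, by rw [card_erase_of_mem h.2, h.1.2]; simp⟩
  · rintro ⟨i, t⟩ h
    simp only [mem_sigma, mem_powersetCard] at h ⊢
    have hi : i ∉ t := fun hi => by simpa using h.2.1 hi
    exact ⟨⟨insert_subset h.1 (h.2.1.trans (erase_subset _ _)),
      by rw [card_insert_of_notMem hi, h.2.2]⟩, mem_insert_self _ _⟩
  · rintro ⟨s, i⟩ h
    simp only [mem_sigma] at h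
    simp [insert_erase h.2]
  · rintro ⟨i, t⟩ h
    simp only [mem_sigma, mem_powersetCard] at h
    have hi : i ∉ t := fun hi => by simpa using h.2.1 hi
    simp [erase_insert hi]
  · rintro ⟨s, i⟩ h
    rfl

theorem sigmaMat_natCast {n : ℕ} (A : Matrix (Fin n) (Fin n) ℝ) (m : ℕ) :
    sigmaMat A m = ∑ s ∈ powersetCard m univ,
      (A.submatrix (Subtype.val : s → Fin n) (Subtype.val : s → Fin n)).det := by
  simp [sigmaMat]

theorem sigmaMat_diagonal {n : ℕ} (lam : Fin n → ℝ) (m : ℕ) :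
    sigmaMat (Matrix.diagonal lam) m = esymmOn univ lam m := by
  rw [sigmaMat_natCast, esymmOn_natCast]
  refine Finset.sum_congr rfl fun s _ => ?_
  rw [Matrix.submatrix_diagonal _ _ Subtype.val_injective, Matrix.det_diagonal]
  exact Finset.prod_coe_sort s lam

theorem hasDerivAt_sigmaMat_of_diagonal {n : ℕ} {A : ℝ → Matrix (Fin n) (Fin n) ℝ}
    {A' : Matrix (Fin n) (Fin n) ℝ} {lam : Fin n → ℝ} {a : ℝ}
    (hA : ∀ i j, HasDerivAt (fun t => A t i j) (A' i j) a) (h0 : A a = Matrix.diagonal lam)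
    (m : ℕ) :
    HasDerivAt (fun t => sigmaMat (A t) m)
      (∑ i, esymmOn (univ.erase i) lam (m - 1) * A' i i) a := by
  simp only [sigmaMat_natCast]
  rw [← sum_powersetCard_prod_erase univ lam (fun i => A' i i) m]
  refine HasDerivAt.fun_sum fun s _ => ?_
  have h := hasDerivAt_det_of_diagonal (a := a) (lam := fun i : s => lam i)
    (A := fun t => (A t).submatrix (Subtype.val : s → Fin n) (Subtype.val : s → Fin n))
    (A' := A'.submatrix (Subtype.val : s → Fin n) (Subtype.val : s → Fin n))
    (fun i j => hA i j) (by
      rw [h0, Matrix.submatrix_diagonal _ _ Subtype.val_injective]; rfl)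
  refine h.congr_deriv ?_
  rw [← Finset.sum_coe_sort s]
  refine Finset.sum_congr rfl fun i _ => ?_
  congr 1
  refine Finset.prod_bij' (fun j _ => (j : Fin n)) (fun j hj => ⟨j, mem_of_mem_erase hj⟩)
    (fun j hj => mem_erase.2 ⟨fun h => ne_of_mem_erase hj (Subtype.ext h), j.2⟩)
    (fun j hj => mem_erase.2 ⟨fun h => ne_of_mem_erase hj (Subtype.ext_iff.1 h), mem_univ _⟩)
    (fun _ _ => rfl) (fun _ _ => rfl) (fun _ _ => rfl)

theorem sigmaMat_mul_comm {n : ℕ} (A B : Matrix (Fin n) (Fin n) ℝ) (m : ℕ) :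
    sigmaMat (A * B) m = sigmaMat (B * A) m := by
  open Polynomial in
  rw [sigmaMat_natCast, sigmaMat_natCast, ← Matrix.coeff_det_one_add_X_smul_eq_sum_minors,
    ← Matrix.coeff_det_one_add_X_smul_eq_sum_minors, Matrix.map_mul, Matrix.map_mul,
    ← Matrix.smul_mul, Matrix.det_one_add_mul_comm, Matrix.mul_smul]

theorem sigmaMat_orthonormalBasis {n : ℕ}
    (b : OrthonormalBasis (Fin n) ℝ (EuclideanSpace ℝ (Fin n)))
    (B : EuclideanSpace ℝ (Fin n) →L[ℝ] EuclideanSpace ℝ (Fin n) →L[ℝ] ℝ) (m : ℕ) :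
    sigmaMat (fun i j => B (b i) (b j)) m =
      sigmaMat (fun i j => B (EuclideanSpace.single i 1) (EuclideanSpace.single j 1)) m := by
  set M : Matrix (Fin n) (Fin n) ℝ :=
    fun i j => B (EuclideanSpace.single i 1) (EuclideanSpace.single j 1)
  set Q : Matrix (Fin n) (Fin n) ℝ := fun j i => b i j
  have hx : ∀ x : EuclideanSpace ℝ (Fin n), x = ∑ j, x j • EuclideanSpace.single j (1 : ℝ) := by
    intro x
    simpa using ((EuclideanSpace.basisFun (Fin n) ℝ).sum_repr x).symm
  have h1 : (fun i j => B (b i) (b j) : Matrix (Fin n) (Fin n) ℝ) = Q.transpose * (M * Q) := by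
    ext i j
    conv_lhs => rw [hx (b i), hx (b j)]
    simp only [map_sum, map_smul, _root_.sum_apply, _root_.smul_apply,
      Matrix.mul_apply, Matrix.transpose_apply, smul_eq_mul]
    rw [Finset.sum_congr rfl fun _ _ => Finset.mul_sum _ _ _]
    simp only [Finset.mul_sum]
    rw [Finset.sum_comm]
    refine Finset.sum_congr rfl fun p _ => Finset.sum_congr rfl fun q _ => ?_
    simp only [M, Q]; ring
  have h2 : Q.transpose * Q = 1 := by
    ext i j
    have := orthonormal_iff_ite.1 b.orthonormal i j
    rw [Matrix.mul_apply, Matrix.one_apply, ← this, PiLp.inner_apply]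
    exact Finset.sum_congr rfl fun p _ => by
      change b i p * b j p = _
      simp [mul_comm]
  rw [h1, sigmaMat_mul_comm, Matrix.mul_assoc, mul_eq_one_comm.1 h2, Matrix.mul_one]

end Minors

section Geometry

open Topology

theorem HasFDerivAt.hasDerivAt_line {E F : Type*} [NormedAddCommGroup E] [NormedSpace ℝ E]
    [NormedAddCommGroup F] [NormedSpace ℝ F] {g : E → F} {g' : E →L[ℝ] F} {y e : E} {t : ℝ}
    (hg : HasFDerivAt g g' (y + t • e)) : HasDerivAt (fun s : ℝ => g (y + s • e)) (g' e) t := by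
  have h : HasDerivAt (fun s : ℝ => y + s • e) e t := by
    simpa using ((hasDerivAt_id t).smul_const e).const_add y
  exact hg.comp_hasDerivAt t h

theorem tendsto_line {E : Type*} [NormedAddCommGroup E] [NormedSpace ℝ E] (y e : E) :
    Filter.Tendsto (fun t : ℝ => y + t • e) (𝓝 0) (𝓝 y) := by
  have : Continuous fun t : ℝ => y + t • e := by fun_prop
  simpa using this.tendsto 0

theorem OrthonormalBasis.sum_sq_apply_dual {ι E : Type*} [Fintype ι] [NormedAddCommGroup E]
    [InnerProductSpace ℝ E] [CompleteSpace E] (b : OrthonormalBasis ι ℝ E) (L : E →L[ℝ] ℝ) :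
    ∑ i, L (b i) ^ 2 = ‖L‖ ^ 2 := by
  have h := b.sum_sq_norm_inner_right ((InnerProductSpace.toDual ℝ E).symm L)
  rw [LinearIsometryEquiv.norm_map] at h
  rw [← h]
  refine Finset.sum_congr rfl fun i _ => ?_
  rw [real_inner_comm, InnerProductSpace.toDual_symm_apply, Real.norm_eq_abs, sq_abs]

theorem exists_orthonormalBasis_diagonal {n : ℕ} {E : Type*} [NormedAddCommGroup E]
    [InnerProductSpace ℝ E] [FiniteDimensional ℝ E] (hn : Module.finrank ℝ E = n)
    {B : E →L[ℝ] E →L[ℝ] ℝ} (hB : ∀ v w, B v w = B w v) :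
    ∃ (b : OrthonormalBasis (Fin n) ℝ E) (lam : Fin n → ℝ),
      ∀ i j, B (b i) (b j) = if i = j then lam i else 0 := by
  let S : E →ₗ[ℝ] E :=
    { toFun := fun x => (InnerProductSpace.toDual ℝ E).symm (B x)
      map_add' := fun x y => by simp
      map_smul' := fun c x => by simp }
  have hS : ∀ x y, inner ℝ (S x) y = B x y := fun x y => InnerProductSpace.toDual_symm_apply
  have hsymm : S.IsSymmetric := fun x y => by
    rw [hS, real_inner_comm, hS, hB]
  refine ⟨hsymm.eigenvectorBasis hn, hsymm.eigenvalues hn, fun i j => ?_⟩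
  rw [← hS, hsymm.apply_eigenvectorBasis, real_inner_smul_left,
    orthonormal_iff_ite.1 (hsymm.eigenvectorBasis hn).orthonormal i j]
  simp

theorem sum_quotientCoeff_mul_eq {n k l : ℕ}
    {H : EuclideanSpace ℝ (Fin n) →
      EuclideanSpace ℝ (Fin n) →L[ℝ] EuclideanSpace ℝ (Fin n) →L[ℝ] ℝ}
    {T : EuclideanSpace ℝ (Fin n) →L[ℝ] EuclideanSpace ℝ (Fin n) →L[ℝ]
      EuclideanSpace ℝ (Fin n) →L[ℝ] ℝ}
    {f : EuclideanSpace ℝ (Fin n) → ℝ} {f' : EuclideanSpace ℝ (Fin n) →L[ℝ] ℝ}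
    {y : EuclideanSpace ℝ (Fin n)} (hH : HasFDerivAt H T y) (hf : HasFDerivAt f f' y)
    (heq : ∀ᶠ z in 𝓝 y,
      sigmaMat (fun i j => H z (EuclideanSpace.single i 1) (EuclideanSpace.single j 1)) k =
      f z * sigmaMat (fun i j => H z (EuclideanSpace.single i 1) (EuclideanSpace.single j 1)) l)
    (b : OrthonormalBasis (Fin n) ℝ (EuclideanSpace ℝ (Fin n))) {lam : Fin n → ℝ}
    (hb : ∀ i j, H y (b i) (b j) = if i = j then lam i else 0) (d : EuclideanSpace ℝ (Fin n)) :
    ∑ i, quotientCoeff univ lam k l i * T d (b i) (b i) = esymmOn univ lam l ^ 2 * f' d := by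
  simp only [← sigmaMat_orthonormalBasis b] at heq
  have hdiag : (fun i j => H (y + (0 : ℝ) • d) (b i) (b j) : Matrix (Fin n) (Fin n) ℝ) =
      Matrix.diagonal lam := by
    ext i j
    simp [hb, Matrix.diagonal_apply]
  have h0 : y = y + (0 : ℝ) • d := by simp
  have hA : ∀ i j, HasDerivAt (fun t : ℝ => H (y + t • d) (b i) (b j)) (T d (b i) (b j)) 0 := by
    intro i j
    rw [h0] at hH
    have h1 := HasFDerivAt.hasDerivAt_line
      (F := EuclideanSpace ℝ (Fin n) →L[ℝ] EuclideanSpace ℝ (Fin n) →L[ℝ] ℝ) hH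
    have h2 := (h1.clm_apply (hasDerivAt_const (0 : ℝ) (b i))).clm_apply
      (hasDerivAt_const (0 : ℝ) (b j))
    simpa using h2
  have hk := hasDerivAt_sigmaMat_of_diagonal
    (A := fun t i j => H (y + t • d) (b i) (b j)) (A' := fun i j => T d (b i) (b j)) hA hdiag k
  have hl := hasDerivAt_sigmaMat_of_diagonal
    (A := fun t i j => H (y + t • d) (b i) (b j)) (A' := fun i j => T d (b i) (b j)) hA hdiag l
  rw [h0] at hf
  have hfl := hf.hasDerivAt_line.mul hl
  have hev := (tendsto_line y d).eventually heq
  have hu := hk.unique (hfl.congr_of_eventuallyEq hev)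
  have h0' := hev.self_of_nhds
  simp only [hdiag, sigmaMat_diagonal] at hu h0'
  simp only [quotientCoeff, sub_mul, Finset.sum_sub_distrib, mul_assoc, ← Finset.mul_sum]
  rw [hu, h0']
  ring

end Geometry

section Critical

open Topology

theorem hessian_eq_fderiv_fderiv {n : ℕ} {u : EuclideanSpace ℝ (Fin n) → ℝ}
    {z : EuclideanSpace ℝ (Fin n)} (hu : DifferentiableAt ℝ (fderiv ℝ u) z) :
    hessian u z = fun i j => fderiv ℝ (fderiv ℝ u) z (EuclideanSpace.single i 1)
      (EuclideanSpace.single j 1) := by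
  ext i j
  have h := hu.hasFDerivAt.clm_apply (hasFDerivAt_const (EuclideanSpace.single j (1 : ℝ)) z)
  rw [hessian, h.fderiv]
  simp

theorem fderiv_fderiv_fderiv_symm_right {E : Type*} [NormedAddCommGroup E] [NormedSpace ℝ E]
    {u : E → ℝ} {y : E} (hu : ContDiffAt ℝ 3 u y) (a v w : E) :
    fderiv ℝ (fderiv ℝ (fderiv ℝ u)) y a v w = fderiv ℝ (fderiv ℝ (fderiv ℝ u)) y a w v := by
  have hH : HasFDerivAt (fderiv ℝ (fderiv ℝ u)) (fderiv ℝ (fderiv ℝ (fderiv ℝ u)) y) y :=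
    (((hu.fderiv_right (m := 2) (by norm_num)).fderiv_right (m := 1)
      (by norm_num)).differentiableAt (by norm_num)).hasFDerivAt
  have key : ∀ p q : E, HasFDerivAt (fun z => fderiv ℝ (fderiv ℝ u) z p q)
      (((fderiv ℝ (fderiv ℝ (fderiv ℝ u)) y).flip p).flip q) y := fun p q => by
    simpa using (hH.clm_apply (hasFDerivAt_const p y)).clm_apply (hasFDerivAt_const q y)
  have hev : (fun z => fderiv ℝ (fderiv ℝ u) z v w) =ᶠ[𝓝 y]
      fun z => fderiv ℝ (fderiv ℝ u) z w v := by
    filter_upwards [hu.eventually (by norm_num)] with z hz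
    exact hz.isSymmSndFDerivAt
      (by rw [minSmoothness_of_isRCLikeNormedField]; norm_num) v w
  have h := (key v w).unique ((key w v).congr_of_eventuallyEq hev)
  simpa using congrArg (fun L => L a) h

theorem fderiv_fderiv_fderiv_symm_left {E : Type*} [NormedAddCommGroup E] [NormedSpace ℝ E]
    {u : E → ℝ} {y : E} (hu : ContDiffAt ℝ 3 u y) (v w a : E) :
    fderiv ℝ (fderiv ℝ (fderiv ℝ u)) y v w a = fderiv ℝ (fderiv ℝ (fderiv ℝ u)) y w v a := by
  rw [(hu.fderiv_right (m := 2) (by norm_num)).isSymmSndFDerivAt (by simp) v w]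

theorem norm_fderiv_mul_le_of_isLocalMax {n k l : ℕ} (hlk : l < k)
    {u f : EuclideanSpace ℝ (Fin n) → ℝ} {x₀ y : EuclideanSpace ℝ (Fin n)} {B M R E : ℝ}
    (hu : ContDiffAt ℝ 3 u y) (hf : DifferentiableAt ℝ f y) (hB : 0 ≤ B)
    (hfB : ‖fderiv ℝ f y‖ ≤ B) (hadm : kAdmissibleAt k u y)
    (heq : ∀ᶠ z in 𝓝 y, sigmaMat (hessian u z) k = f z * sigmaMat (hessian u z) l)
    (hR : 0 < R) (hr : 0 < R ^ 2 - ‖y - x₀‖ ^ 2) (hp : 0 < ‖fderiv ℝ u y‖)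
    (hD : 1 ≤ M - u y) (hDE : M - u y ≤ E)
    (hmax : IsLocalMax (fun z => 2 * Real.log (‖fderiv ℝ u z‖ ^ 2) +
      4 * Real.log (R ^ 2 - ‖z - x₀‖ ^ 2) - Real.log (M - u z)) y) :
    ‖fderiv ℝ u y‖ * (R ^ 2 - ‖y - x₀‖ ^ 2) ≤ 8 * E * R ^ 2 + 16 * E * R +
      8 * E ^ 2 * (n + 1) * (B * R ^ 4 + 14 * R ^ 2 * n) + 1 := by
  have hC2 : ∀ᶠ z in 𝓝 y, ContDiffAt ℝ 3 u z := hu.eventually (by norm_num)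
  have hG : ∀ z, ContDiffAt ℝ 3 u z →
      HasFDerivAt (fderiv ℝ u) (fderiv ℝ (fderiv ℝ u) z) z := fun z hz =>
    ((hz.fderiv_right (m := 2) (by norm_num)).differentiableAt (by norm_num)).hasFDerivAt
  have hH : HasFDerivAt (fderiv ℝ (fderiv ℝ u)) (fderiv ℝ (fderiv ℝ (fderiv ℝ u)) y) y :=
    (((hu.fderiv_right (m := 2) (by norm_num)).fderiv_right (m := 1)
      (by norm_num)).differentiableAt (by norm_num)).hasFDerivAt
  have hsymm := hu.isSymmSndFDerivAt
    (by rw [minSmoothness_of_isRCLikeNormedField]; norm_num)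
  obtain ⟨b, lam, hb⟩ := exists_orthonormalBasis_diagonal (n := n) (by simp) hsymm
  have hess := hessian_eq_fderiv_fderiv (hG y hu).differentiableAt
  have hσ : ∀ m : ℕ, sigmaMat (hessian u y) m = esymmOn univ lam m := fun m => by
    rw [hess, ← sigmaMat_orthonormalBasis b, ← sigmaMat_diagonal]
    congr 1
    ext i j
    simp [hb, Matrix.diagonal_apply]
  have hpos : ∀ m : ℤ, 0 ≤ m → m ≤ k → 0 < esymmOn univ lam m := fun m hm0 hmk => by
    lift m to ℕ using hm0
    rcases Nat.eq_zero_or_pos m with rfl | hm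
    · simp
    · rw [← hσ]
      exact hadm m hm (by exact_mod_cast hmk)
  have heq' : ∀ᶠ z in 𝓝 y,
      sigmaMat (fun i j => fderiv ℝ (fderiv ℝ u) z (EuclideanSpace.single i 1)
        (EuclideanSpace.single j 1)) k =
      f z * sigmaMat (fun i j => fderiv ℝ (fderiv ℝ u) z (EuclideanSpace.single i 1)
        (EuclideanSpace.single j 1)) l := by
    filter_upwards [heq, hC2] with z hz hz'
    rwa [hessian_eq_fderiv_fderiv (hG z hz').differentiableAt] at hz
  set p := ‖fderiv ℝ u y‖ with hpdef
  set w : Fin n → ℝ := fun i => fderiv ℝ u y (b i) with hw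
  have hpw : ∑ i, w i ^ 2 = p ^ 2 := b.sum_sq_apply_dual _
  set d : EuclideanSpace ℝ (Fin n) := ∑ i, w i • b i with hd
  have hdp : ‖d‖ = p := by
    have : ‖d‖ ^ 2 = p ^ 2 := by
      rw [← hpw, ← b.sum_sq_norm_inner_right d]
      refine Finset.sum_congr rfl fun i _ => ?_
      rw [hd, b.orthonormal.inner_right_fintype, Real.norm_eq_abs, sq_abs]
    exact (pow_left_inj₀ (norm_nonneg _) hp.le two_ne_zero).1 this
  have hT := sum_quotientCoeff_mul_eq hH hf.hasFDerivAt heq' b hb d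
  have hφ : |fderiv ℝ f y d| ≤ B * p := by
    rw [← Real.norm_eq_abs, ← hdp]
    exact (ContinuousLinearMap.le_opNorm _ _).trans (by gcongr)
  set ρ : Fin n → ℝ := fun i => -2 * inner ℝ (b i) (y - x₀) with hρdef
  have hρ : ∑ i, ρ i ^ 2 ≤ (2 * R) ^ 2 := by
    have h := b.sum_sq_norm_inner_right (y - x₀)
    simp only [Real.norm_eq_abs, sq_abs] at h
    simp only [hρdef, mul_pow, ← Finset.mul_sum, h]
    linarith
  have hcond : ∀ i, 2 * (2 * (lam i * w i) / p ^ 2) + 4 * (ρ i / (R ^ 2 - ‖y - x₀‖ ^ 2)) +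
        w i / (M - u y) = 0 ∧
      2 * (((2 * lam i ^ 2 + 2 * fderiv ℝ (fderiv ℝ (fderiv ℝ u)) y d (b i) (b i)) * p ^ 2 -
        2 * (lam i * w i) * (2 * (lam i * w i))) / (p ^ 2) ^ 2) +
      4 * ((-2 * (R ^ 2 - ‖y - x₀‖ ^ 2) - ρ i * ρ i) / (R ^ 2 - ‖y - x₀‖ ^ 2) ^ 2) +
        (lam i * (M - u y) + w i * w i) / (M - u y) ^ 2 ≤ 0 := by
    intro i
    have h0 : y + (0 : ℝ) • b i = y := by simp
    have hline := (tendsto_line y (b i)).eventually hC2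
    have hdG : ∀ᶠ t in 𝓝 (0 : ℝ), ∀ j, HasDerivAt (fun s : ℝ => fderiv ℝ u (y + s • b i) (b j))
        (fderiv ℝ (fderiv ℝ u) (y + t • b i) (b i) (b j)) t := by
      filter_upwards [hline] with t ht j
      have h1 := HasFDerivAt.hasDerivAt_line (hG _ ht)
      simpa using h1.clm_apply (hasDerivAt_const t (b j))
    have hdH : ∀ j, HasDerivAt (fun s : ℝ => fderiv ℝ (fderiv ℝ u) (y + s • b i) (b i) (b j))
        (fderiv ℝ (fderiv ℝ (fderiv ℝ u)) y (b i) (b i) (b j)) 0 := by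
      intro j
      have hH' := hH
      rw [← h0] at hH'
      have h1 := HasFDerivAt.hasDerivAt_line
        (F := EuclideanSpace ℝ (Fin n) →L[ℝ] EuclideanSpace ℝ (Fin n) →L[ℝ] ℝ) hH'
      rw [h0] at h1
      simpa using (h1.clm_apply (hasDerivAt_const (0 : ℝ) (b i))).clm_apply
        (hasDerivAt_const (0 : ℝ) (b j))
    have hv : ∀ᶠ t in 𝓝 (0 : ℝ), HasDerivAt
        (fun s : ℝ => ∑ j, fderiv ℝ u (y + s • b i) (b j) ^ 2)
        (∑ j, 2 * (fderiv ℝ u (y + t • b i) (b j) *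
          fderiv ℝ (fderiv ℝ u) (y + t • b i) (b i) (b j))) t := by
      filter_upwards [hdG] with t ht
      refine HasDerivAt.fun_sum fun j _ => ?_
      convert! (ht j).pow 2 using 1
      ring
    have hv₁ : HasDerivAt (fun t : ℝ => ∑ j, 2 * (fderiv ℝ u (y + t • b i) (b j) *
          fderiv ℝ (fderiv ℝ u) (y + t • b i) (b i) (b j)))
        (∑ j, 2 * (fderiv ℝ (fderiv ℝ u) y (b i) (b j) * fderiv ℝ (fderiv ℝ u) y (b i) (b j) +
          fderiv ℝ u y (b j) * fderiv ℝ (fderiv ℝ (fderiv ℝ u)) y (b i) (b i) (b j))) 0 := by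
      refine HasDerivAt.fun_sum fun j _ => ?_
      have := ((hdG.self_of_nhds j).fun_mul (hdH j)).const_mul 2
      simpa only [h0] using this
    have hr₀ : ∀ t : ℝ, HasDerivAt (fun s : ℝ => R ^ 2 - ‖y + s • b i - x₀‖ ^ 2)
        (ρ i - 2 * t) t := by
      intro t
      have e : (fun s : ℝ => R ^ 2 - ‖y + s • b i - x₀‖ ^ 2) =
          fun s => R ^ 2 - (‖y - x₀‖ ^ 2 + 2 * (s * inner ℝ (b i) (y - x₀)) + s ^ 2) := by
        ext s
        rw [show y + s • b i - x₀ = (y - x₀) + s • b i by abel, norm_add_sq_real,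
          real_inner_smul_right, real_inner_comm, norm_smul, b.norm_eq_one, mul_one,
          Real.norm_eq_abs, sq_abs]
      rw [e]
      have h1 := (((((hasDerivAt_id t).mul_const (inner ℝ (b i) (y - x₀))).const_mul 2).const_add
        (‖y - x₀‖ ^ 2)).add ((hasDerivAt_id t).pow 2)).const_sub (R ^ 2)
      convert! h1 using 1
      simp only [hρdef, id]
      ring
    have hr₁ : HasDerivAt (fun t : ℝ => ρ i - 2 * t) (-2) 0 := by
      simpa using ((hasDerivAt_id (0 : ℝ)).const_mul 2).const_sub (ρ i)
    have hD₀ : ∀ᶠ t in 𝓝 (0 : ℝ), HasDerivAt (fun s : ℝ => M - u (y + s • b i))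
        (-fderiv ℝ u (y + t • b i) (b i)) t := by
      filter_upwards [hline] with t ht
      exact ((ht.differentiableAt (by norm_num)).hasFDerivAt.hasDerivAt_line).const_sub M
    have hD₁ : HasDerivAt (fun t : ℝ => -fderiv ℝ u (y + t • b i) (b i)) (-lam i) 0 := by
      have := (hdG.self_of_nhds i).fun_neg
      simpa only [h0, hb, if_true] using this
    have hmax' : IsLocalMax (fun t : ℝ =>
        2 * Real.log (∑ j, fderiv ℝ u (y + t • b i) (b j) ^ 2) +
        4 * Real.log (R ^ 2 - ‖y + t • b i - x₀‖ ^ 2) - Real.log (M - u (y + t • b i))) 0 := by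
      simp only [b.sum_sq_apply_dual]
      have := (tendsto_line y (b i)).eventually hmax
      filter_upwards [this] with t ht
      simpa only [h0] using ht
    have key := hmax'.log_conditions hv (Filter.Eventually.of_forall hr₀) hD₀ hv₁ hr₁ hD₁
      (by simpa only [h0, b.sum_sq_apply_dual] using pow_pos hp 2)
      (by simpa only [h0] using hr) (by simp only [h0]; linarith)
    have e1 : ∑ j, 2 * (fderiv ℝ u y (b j) * fderiv ℝ (fderiv ℝ u) y (b i) (b j)) =
        2 * (lam i * w i) := by
      simp [hb, hw, mul_comm]
    have e2 : ∑ j, 2 * (fderiv ℝ (fderiv ℝ u) y (b i) (b j) *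
          fderiv ℝ (fderiv ℝ u) y (b i) (b j) +
          fderiv ℝ u y (b j) * fderiv ℝ (fderiv ℝ (fderiv ℝ u)) y (b i) (b i) (b j)) =
        2 * lam i ^ 2 + 2 * fderiv ℝ (fderiv ℝ (fderiv ℝ u)) y d (b i) (b i) := by
      rw [fderiv_fderiv_fderiv_symm_left hu d, fderiv_fderiv_fderiv_symm_right hu (b i) d, hd,
        map_sum, ← Finset.mul_sum, Finset.sum_add_distrib, ← mul_add]
      congr 2
      · simp [hb, sq]
      · simp [hw]
    simp only [h0, e1, e2, b.sum_sq_apply_dual, mul_zero, sub_zero, ← hpdef] at key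
    constructor
    · linear_combination key.1
    · refine le_of_eq_of_le ?_ key.2
      ring
  have := critical_point_bound hlk hpos hp hpw hr (by nlinarith [sq_nonneg ‖y - x₀‖]) hR hD hDE
    hB hρ (fun i _ => (hcond i).1) (fun i _ => (hcond i).2) hT hφ
  simpa using this

end Critical

/-- Theorem 4.2 (interior gradient bound away from the boundary): for 0 ≤ l < k ≤ n,
μ > 0 and B₀, B₁ ≥ 0 there is M₁ = M₁(n,k,l,μ,B₀,B₁) > 0 such that every
k-admissible C³ solution u of σ_k(D²u)/σ_l(D²u) = f in a bounded open Ω with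
sup|u| ≤ B₀, f positive and C¹ with sup_Ω|Df| ≤ B₁, satisfies |Du(x)| ≤ M₁ at every
x ∈ Ω with dist(x, ∂Ω) ≥ μ. -/
theorem interior_gradient_bound (n k l : ℕ) (hlk : l < k) (hkn : k ≤ n)
    (μ B₀ B₁ : ℝ) (hμ : 0 < μ) (hB₀ : 0 ≤ B₀) (hB₁ : 0 ≤ B₁) :
    ∃ M₁ : ℝ, 0 < M₁ ∧
      ∀ (Ω : Set (EuclideanSpace ℝ (Fin n))), IsOpen Ω → Bornology.IsBounded Ω →
      ∀ (f : EuclideanSpace ℝ (Fin n) → ℝ), ContDiff ℝ 1 f →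
        (∀ x ∈ closure Ω, 0 < f x) →
        (∀ x ∈ Ω, ‖fderiv ℝ f x‖ ≤ B₁) →
      ∀ (u : EuclideanSpace ℝ (Fin n) → ℝ), ContDiffOn ℝ 3 u Ω →
        (∀ x ∈ Ω, kAdmissibleAt k u x ∧
          sigmaMat (hessian u x) (k : ℤ) / sigmaMat (hessian u x) (l : ℤ) = f x) →
        (∀ x ∈ Ω, |u x| ≤ B₀) →
      ∀ x ∈ Ω, μ ≤ Metric.infDist x (frontier Ω) → ‖gradient u x‖ ≤ M₁ := by
  set R : ℝ := μ / 2 with hRdef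
  set E : ℝ := 3 * B₀ + 1 with hEdef
  set C : ℝ := 8 * E * R ^ 2 + 16 * E * R +
    8 * E ^ 2 * (n + 1) * (B₁ * R ^ 4 + 14 * R ^ 2 * n) + 1 with hCdef
  have hR : 0 < R := by positivity
  have hE : 1 ≤ E := by linarith
  have hC : 0 < C := by positivity
  clear_value C E R
  refine ⟨C * E / R ^ 2, by positivity, ?_⟩
  intro Ω hΩ _ f hf _ hfB u hu hsol huB x hx hdist
  have hgrad : ‖gradient u x‖ = ‖fderiv ℝ u x‖ := LinearIsometryEquiv.norm_map _ _
  rw [hgrad]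
  rcases (norm_nonneg (fderiv ℝ u x)).eq_or_lt with h0 | hpx
  · rw [← h0]; positivity
  have hball : Metric.closedBall x R ⊆ Ω := by
    refine (Metric.closedBall_subset_ball (by linarith : R < μ)).trans ?_
    refine (convex_ball x μ).isPreconnected.subset_of_closure_inter_subset hΩ
      ⟨x, Metric.mem_ball_self hμ, hx⟩ fun z hz => ?_
    by_contra hzΩ
    have hzf : z ∈ frontier Ω := hΩ.frontier_eq ▸ ⟨hz.1, hzΩ⟩
    have h1 := Metric.infDist_le_dist_of_mem (x := x) hzf
    have h2 := hz.2
    rw [Metric.mem_ball, dist_comm] at h2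
    linarith
  have hCD : ∀ z ∈ Ω, ContDiffAt ℝ 3 u z := fun z hz => hu.contDiffAt (hΩ.mem_nhds hz)
  have hD : ∀ z ∈ Ω, 1 ≤ 2 * B₀ + 1 - u z ∧ 2 * B₀ + 1 - u z ≤ E := fun z hz => by
    have := abs_le.1 (huB z hz)
    constructor <;> linarith
  set W : EuclideanSpace ℝ (Fin n) → ℝ := fun z =>
    (‖fderiv ℝ u z‖ ^ 2) ^ 2 * (R ^ 2 - ‖z - x‖ ^ 2) ^ 4 / (2 * B₀ + 1 - u z) with hW
  have hWc : ContinuousOn W (Metric.closedBall x R) := by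
    intro z hz
    have hzΩ := hball hz
    have h1 : ContinuousAt (fderiv ℝ u) z :=
      ((hCD z hzΩ).fderiv_right (m := 2) (by norm_num)).continuousAt
    have h2 : ContinuousAt u z := (hCD z hzΩ).continuousAt
    have h3 : 2 * B₀ + 1 - u z ≠ 0 := by linarith [(hD z hzΩ).1]
    exact ContinuousAt.continuousWithinAt (by fun_prop (disch := exact h3))
  obtain ⟨y, hy, hymax⟩ := (isCompact_closedBall x R).exists_isMaxOn
    ⟨x, Metric.mem_closedBall_self hR.le⟩ hWc
  have hyΩ := hball hy
  have hWx : (‖fderiv ℝ u x‖ ^ 2) ^ 2 * (R ^ 2) ^ 4 / E ≤ W x := by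
    simp only [hW, sub_self, norm_zero, ne_eq, OfNat.ofNat_ne_zero, not_false_eq_true, zero_pow,
      sub_zero]
    have := hD x hx
    gcongr
    · linarith
    · linarith
  have hWy : W x ≤ W y := hymax (Metric.mem_closedBall_self hR.le)
  have hWpos : 0 < W y := lt_of_lt_of_le (by positivity) (hWx.trans hWy)
  have hry : 0 < R ^ 2 - ‖y - x‖ ^ 2 := by
    rw [mem_closedBall_iff_norm] at hy
    have h1 : 0 ≤ R ^ 2 - ‖y - x‖ ^ 2 := by
      have := pow_le_pow_left₀ (norm_nonneg _) hy 2
      linarith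
    refine h1.lt_of_ne fun h => ?_
    simp [hW, ← h] at hWpos
  have hpy : 0 < ‖fderiv ℝ u y‖ := by
    refine (norm_nonneg _).lt_of_ne fun h => ?_
    simp [hW, ← h] at hWpos
  have hyball : y ∈ Metric.ball x R := by
    rw [mem_ball_iff_norm]
    exact lt_of_pow_lt_pow_left₀ 2 hR.le (by linarith)
  have hlocal : IsLocalMax (fun z => 2 * Real.log (‖fderiv ℝ u z‖ ^ 2) +
      4 * Real.log (R ^ 2 - ‖z - x‖ ^ 2) - Real.log (2 * B₀ + 1 - u z)) y := by
    have hlog : ∀ z, 0 < ‖fderiv ℝ u z‖ → 0 < R ^ 2 - ‖z - x‖ ^ 2 → z ∈ Ω →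
        Real.log (W z) = 2 * Real.log (‖fderiv ℝ u z‖ ^ 2) +
          4 * Real.log (R ^ 2 - ‖z - x‖ ^ 2) - Real.log (2 * B₀ + 1 - u z) := by
      intro z h1 h2 h3
      have h4 : 2 * B₀ + 1 - u z ≠ 0 := by linarith [(hD z h3).1]
      rw [hW, Real.log_div (by positivity) h4, Real.log_mul (by positivity) (by positivity),
        Real.log_pow, Real.log_pow]
      norm_num
    have hpc : ContinuousAt (fun z => ‖fderiv ℝ u z‖) y :=
      ((hCD y hyΩ).fderiv_right (m := 2) (by norm_num)).continuousAt.norm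
    filter_upwards [Metric.isOpen_ball.mem_nhds hyball, hpc.eventually (lt_mem_nhds hpy)]
      with z hz hpz
    have hzc := Metric.ball_subset_closedBall hz
    have hrz : 0 < R ^ 2 - ‖z - x‖ ^ 2 := by
      rw [mem_ball_iff_norm] at hz
      have := pow_lt_pow_left₀ hz (norm_nonneg _) two_ne_zero
      linarith
    have hzΩ := hball hzc
    rw [← hlog z hpz hrz hzΩ, ← hlog y hpy hry hyΩ]
    have hDz := (hD z hzΩ).1
    exact Real.log_le_log (div_pos (by positivity) (by linarith)) (hymax hzc)
  have heq : ∀ᶠ z in nhds y, sigmaMat (hessian u z) k = f z * sigmaMat (hessian u z) l := by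
    filter_upwards [hΩ.mem_nhds hyΩ] with z hz
    obtain ⟨hadm, hz'⟩ := hsol z hz
    have hl : sigmaMat (hessian u z) l ≠ 0 := by
      rcases Nat.eq_zero_or_pos l with rfl | hl
      · simp [sigmaMat]
      · exact (hadm l hl hlk.le).ne'
    rw [← hz', div_mul_cancel₀ _ hl]
  have hmain : ‖fderiv ℝ u y‖ * (R ^ 2 - ‖y - x‖ ^ 2) ≤ C :=
    norm_fderiv_mul_le_of_isLocalMax hlk (hCD y hyΩ)
      (hf.differentiable (by norm_num) y) hB₁ (hfB y hyΩ) (hsol y hyΩ).1 heq hR hry hpy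
      (hD y hyΩ).1 (hD y hyΩ).2 hlocal |>.trans_eq hCdef.symm
  have hWyC : W y ≤ C ^ 4 := by
    have h1 : W y ≤ (‖fderiv ℝ u y‖ ^ 2) ^ 2 * (R ^ 2 - ‖y - x‖ ^ 2) ^ 4 :=
      div_le_self (by positivity) (hD y hyΩ).1
    refine h1.trans (le_of_eq_of_le ?_ (pow_le_pow_left₀ (by positivity) hmain 4))
    ring
  rw [le_div_iff₀ (by positivity)]
  refine le_of_pow_le_pow_left₀ (n := 4) (by norm_num) (by positivity) ?_
  have h1 := (hWx.trans hWy).trans hWyC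
  rw [div_le_iff₀ (by positivity)] at h1
  calc (‖fderiv ℝ u x‖ * R ^ 2) ^ 4 = (‖fderiv ℝ u x‖ ^ 2) ^ 2 * (R ^ 2) ^ 4 := by ring
    _ ≤ C ^ 4 * E := h1
    _ ≤ C ^ 4 * E ^ 4 := by
      gcongr
      exact le_self_pow₀ hE (by norm_num)
    _ = (C * E) ^ 4 := by ring
end
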